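/- arXiv:1308.0747 — 2 statements merged into one kernel-verified Lean document; each statement's English description precedes it below -/
import Mathlib

section
/- Let n ≥ 1. There exists a set S of polynomials with coefficients in K in the n² matrix entries, not all vanishing at the identity matrix, with the following property. For every u ∈ GL_n(R) at which some polynomial of S does not vanish, setting α := δu·(u^(p))⁻¹, and for every valuation δ-subring O of R containing all entries of α, the δ-Galois group G_{u/O} contains a normal subgroup of finite index which is diagonalizable: there exist a subgroup H of GL_n(R) with H ⊆ G_{u/O} such that c·H·c⁻¹ = H for all c ∈ G_{u/O}, a finite subset T ⊆ G_{u/O} with G_{u/O} = ⋃_{t∈T} t·H, and a matrix g ∈ GL_n(K^a), where K^a is an algebraic closure of K, such that g⁻¹·h·g is a diagonal matrix for every h ∈ H. -/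
set_option synthInstance.maxHeartbeats 1000000
set_option maxHeartbeats 1000000

noncomputable section

open Matrix

/-- `R = W(k)`, `k` the algebraic closure of `𝔽_p`. -/
abbrev Rp (p : ℕ) [Fact p.Prime] : Type _ :=
  WittVector p (AlgebraicClosure (ZMod p))

/-- `φ`, the unique Frobenius lift on `R`. -/
abbrev frobW (p : ℕ) [Fact p.Prime] : Rp p →+* Rp p :=
  WittVector.frobenius

/-- `K`, the fraction field of `R`. -/
abbrev Kp (p : ℕ) [Fact p.Prime] : Type _ := FractionRing (Rp p)

/-- `K^a`, an algebraic closure of `K`. -/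
abbrev Kap (p : ℕ) [Fact p.Prime] : Type _ := AlgebraicClosure (Kp p)

/-- The inclusion `R → K^a`. -/
abbrev toKap (p : ℕ) [Fact p.Prime] : Rp p →+* Kap p :=
  (algebraMap (Kp p) (Kap p)).comp (algebraMap (Rp p) (Kp p))

/-- `O[u]`, the subring of `R` generated by `O` and the entries of `u`. -/
def genBy {p : ℕ} [Fact p.Prime] {n : ℕ} (O : Subring (Rp p))
    (u : Matrix (Fin n) (Fin n) (Rp p)) : Subring (Rp p) :=
  Subring.closure ((O : Set (Rp p)) ∪ {x | ∃ i j, u i j = x})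

lemma mem_genBy {p : ℕ} [Fact p.Prime] {n : ℕ} (O : Subring (Rp p))
    (u : Matrix (Fin n) (Fin n) (Rp p)) (i j : Fin n) : u i j ∈ genBy O u :=
  Subring.subset_closure (Or.inr ⟨i, j, rfl⟩)

/-- The `δ`-Galois group `G_{u/O}`. -/
def galoisGroup {p : ℕ} [Fact p.Prime] (δ : Rp p → Rp p) {n : ℕ} (O : Subring (Rp p))
    (u : Matrix (Fin n) (Fin n) (Rp p)) : Set (Matrix (Fin n) (Fin n) (Rp p)) :=
  {c | (∀ i j, c i j ∈ O) ∧
    (∃ d : Matrix (Fin n) (Fin n) (Rp p),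
      c * d = 1 ∧ d * c = 1 ∧ ∀ i j, d i j ∈ O) ∧
    ∃ σ : genBy O u ≃+* genBy O u,
      (∀ x : genBy O u, (x : Rp p) ∈ O → (σ x : Rp p) = x) ∧
      (∀ x y : genBy O u, (y : Rp p) = δ (x : Rp p) →
        (σ y : Rp p) = δ (σ x : Rp p)) ∧
      (∀ i j, (σ ⟨u i j, mem_genBy O u i j⟩ : Rp p) = (u * c) i j)}

/-- A commuting family of matrices of finite order is simultaneously diagonalizable. -/
theorem exists_simultaneous_diagonalization {L ι m : Type*} [Field L] [IsAlgClosed L] [CharZero L]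
    [Fintype m] [DecidableEq m] (f : ι → Matrix m m L) (hc : ∀ i j, Commute (f i) (f j))
    (ho : ∀ i, ∃ k, 0 < k ∧ f i ^ k = 1) :
    ∃ g : Matrix m m L, IsUnit g ∧ ∀ i, ∃ d : m → L, f i * g = g * diagonal d := by
  let T : ι → Module.End L (m → L) := fun i => Matrix.toLinAlgEquiv' (f i)
  have hT : ∀ i, (T i).IsSemisimple := by
    intro i
    obtain ⟨k, hk, h⟩ := ho i
    refine Module.End.isSemisimple_of_squarefree_aeval_eq_zero
      (p := (Polynomial.X ^ k - Polynomial.C 1 : Polynomial L)) ?_ ?_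
    · exact (Polynomial.separable_X_pow_sub_C (1 : L) (by exact_mod_cast hk.ne')
        one_ne_zero).squarefree
    · have hk : T i ^ k = 1 := by rw [← map_pow, h, map_one]
      simp [hk]
  have htop := Module.End.iSup_iInf_maxGenEigenspace_eq_top_of_iSup_maxGenEigenspace_eq_top_of_commute
    T (fun i j _ => (hc i j).map _) (fun i => Module.End.iSup_maxGenEigenspace_eq_top (T i))
  let S : Set (m → L) := {v | ∀ i, ∃ μ : L, T i v = μ • v}
  have hS : ⊤ ≤ Submodule.span L S := by
    rw [← htop, iSup_le_iff]
    intro χ v hv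
    refine Submodule.subset_span fun i => ⟨χ i, ?_⟩
    have hvi := (Submodule.mem_iInf _).1 hv i
    rw [(hT i).isFinitelySemisimple.maxGenEigenspace_eq_eigenspace] at hvi
    exact Module.End.mem_eigenspace_iff.1 hvi
  let b₀ := Module.Basis.ofSpan hS
  have : Fintype _ := FiniteDimensional.fintypeBasisIndex b₀
  have e := Fintype.equivOfCardEq (α := _) (β := m)
    ((Module.finrank_eq_card_basis b₀).symm.trans (Module.finrank_fintype_fun_eq_card L))
  let b := b₀.reindex e
  have hb : ∀ j i, ∃ μ : L, T i (b j) = μ • b j := by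
    intro j
    have : b j ∈ S := Module.Basis.ofSpan_subset hS ⟨e.symm j, by simp [b, b₀]⟩
    exact this
  choose μ hμ using hb
  let g : Matrix m m L := (Pi.basisFun L m).toMatrix b
  have : Invertible g := Module.Basis.invertibleToMatrix _ _
  refine ⟨g, isUnit_of_invertible g, fun i => ⟨fun j => μ j i, ?_⟩⟩
  ext x j
  have := congrFun (hμ j i) x
  simp only [T, Matrix.toLinAlgEquiv'_apply, mulVec, dotProduct, Pi.smul_apply, smul_eq_mul] at this
  simp [Matrix.mul_apply, g, Module.Basis.toMatrix_apply, this, mul_comm, Matrix.diagonal_apply]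

open scoped ComplexOrder in
/-- Every finite-dimensional complex representation of a finite group is unitarizable. -/
theorem exists_unitary_conj {Γ m : Type*} [Group Γ] [Finite Γ] [Fintype m] [DecidableEq m]
    (ρ : Γ →* Matrix m m ℂ) :
    ∃ s : (Matrix m m ℂ)ˣ, ∀ γ, (s : Matrix m m ℂ) * ρ γ * (↑s⁻¹ : Matrix m m ℂ) ∈
      unitary (Matrix m m ℂ) := by
  classical
  have := Fintype.ofFinite Γ
  let P : Matrix m m ℂ := ∑ γ, (ρ γ)ᴴ * ρ γ
  have hP : P.PosDef := by
    have h : P = 1 + ∑ γ ∈ Finset.univ.erase 1, (ρ γ)ᴴ * ρ γ := by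
      simp only [P, ← Finset.add_sum_erase _ _ (Finset.mem_univ (1 : Γ))]
      simp
    rw [h]
    exact PosDef.one.add_posSemidef
      (posSemidef_sum _ fun γ _ => posSemidef_conjTranspose_mul_self _)
  have hinv : ∀ x, (ρ x)ᴴ * P * ρ x = P := by
    intro x
    simp only [P, Finset.mul_sum, Finset.sum_mul]
    refine Fintype.sum_equiv (Equiv.mulRight x) _ _ fun γ => ?_
    simp [Matrix.mul_assoc]
  open scoped MatrixOrder Matrix.Norms.L2Operator in
  obtain ⟨B, hB, hPB⟩ := CStarAlgebra.isStrictlyPositive_iff_eq_star_mul_self.mp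
    (Matrix.isStrictlyPositive_iff_posDef.2 hP)
  obtain ⟨s, rfl⟩ := hB
  refine ⟨s, fun γ => ?_⟩
  have hl : star ((s : Matrix m m ℂ) * ρ γ * (↑s⁻¹ : Matrix m m ℂ)) *
      ((s : Matrix m m ℂ) * ρ γ * (↑s⁻¹ : Matrix m m ℂ)) = 1 := by
    have h := hinv γ
    rw [hPB, ← star_eq_conjTranspose] at h
    calc _ = star (↑s⁻¹ : Matrix m m ℂ) * (star (ρ γ) * (star (s : Matrix m m ℂ) * s) * ρ γ)
          * (↑s⁻¹ : Matrix m m ℂ) := by simp only [star_mul, mul_assoc]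
      _ = star ((s : Matrix m m ℂ) * (↑s⁻¹ : Matrix m m ℂ)) * (s * (↑s⁻¹ : Matrix m m ℂ)) := by
        rw [h]; simp only [star_mul, mul_assoc]
      _ = 1 := by simp
  exact ⟨hl, mul_eq_one_comm.1 hl⟩

open scoped Matrix.Norms.L2Operator in
/-- The norm of `A - 1` for a unitary matrix `A` is controlled by the eigenvalues of `A`. -/
theorem norm_sub_one_lt_of_unitary {m : Type*} [Fintype m] [DecidableEq m] {A : Matrix m m ℂ}
    (hA : A ∈ unitary (Matrix m m ℂ)) {ε : ℝ} (hε : 0 < ε)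
    (h : ∀ z ∈ spectrum ℂ A, ‖z - 1‖ < ε) : ‖A - 1‖ < ε := by
  have hn : IsStarNormal (A - 1) := by
    have h1 := hA.1
    have h2 := hA.2
    refine ⟨?_⟩
    simp only [Commute, SemiconjBy, star_sub, star_one, sub_mul, mul_sub, h1, h2, one_mul, mul_one]
    abel
  by_cases hs : (spectrum ℂ (A - 1)).Nonempty
  · obtain ⟨z, hz, hzr⟩ := spectrum.exists_nnnorm_eq_spectralRadius_of_nonempty hs
    rw [IsStarNormal.spectralRadius_eq_nnnorm] at hzr
    have hz' : ‖z‖ = ‖A - 1‖ := by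
      have h : ‖z‖₊ = ‖A - 1‖₊ := by exact_mod_cast hzr
      simpa using congrArg NNReal.toReal h
    rw [← hz']
    have := h (z + 1) (by
      rw [spectrum.add_mem_iff]
      convert hz using 1
      rw [map_one, neg_add_eq_sub])
    simpa using this
  · have : spectralRadius ℂ (A - 1) = 0 := by
      rw [Set.not_nonempty_iff_eq_empty] at hs
      simp [spectralRadius, hs]
    rw [IsStarNormal.spectralRadius_eq_nnnorm] at this
    have : ‖A - 1‖ = 0 := by simpa using this
    rwa [this]

open scoped Matrix.Norms.L2Operator in
/-- Eigenvectors of a unitary matrix for distinct eigenvalues are orthogonal. -/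
theorem dotProduct_eq_zero_of_unitary {m : Type*} [Fintype m] [DecidableEq m] {A : Matrix m m ℂ}
    (hA : A ∈ unitary (Matrix m m ℂ)) {v w : m → ℂ} {a b : ℂ} (hab : a ≠ b)
    (hv : A *ᵥ v = a • v) (hw : A *ᵥ w = b • w) : star v ⬝ᵥ w = 0 := by
  have h1 : star A * A = 1 := hA.1
  have key : ∀ {x y : m → ℂ} {r s : ℂ}, A *ᵥ x = r • x → A *ᵥ y = s • y →
      star r * s * (star x ⬝ᵥ y) = star x ⬝ᵥ y := by
    intro x y r s hx hy
    have : star (A *ᵥ x) ⬝ᵥ (A *ᵥ y) = star x ⬝ᵥ y := by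
      rw [star_mulVec, ← dotProduct_mulVec, mulVec_mulVec, ← star_eq_conjTranspose, h1, one_mulVec]
    rw [hx, hy] at this
    simpa [mul_assoc, mul_left_comm] using this
  by_cases hv0 : v = 0
  · simp [hv0]
  have hvv := key hv hv
  have hvw := key hv hw
  have hne : star v ⬝ᵥ v ≠ 0 := by
    open scoped ComplexOrder in
    rwa [Ne, dotProduct_star_self_eq_zero]
  have haa : star a * a = 1 := by simpa [hne] using hvv
  by_contra h0
  have hab' : star a * b = 1 := by simpa [h0] using hvw
  have : star a ≠ 0 := left_ne_zero_of_mul_eq_one haa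
  exact hab (mul_left_cancel₀ this (haa.trans hab'.symm))

open scoped Matrix.Norms.L2Operator in
/-- Frobenius' lemma: if `B` is unitary and close to `1` and the unitary matrix `A` of finite order
commutes with its conjugate by `B`, then `A` commutes with `B`. -/
theorem commute_of_commute_conj {m : Type*} [Fintype m] [DecidableEq m] {A B : Matrix m m ℂ}
    (hA : A ∈ unitary (Matrix m m ℂ)) (hB : B ∈ unitary (Matrix m m ℂ))
    (ho : ∃ k, 0 < k ∧ A ^ k = 1) (hB1 : ‖B - 1‖ < 1)
    (hc : Commute A (B * A * star B)) : Commute A B := by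
  have hsB : star B * B = 1 := hB.1
  have hBs : B * star B = 1 := hB.2
  have ho' : ∃ k, 0 < k ∧ (B * A * star B) ^ k = 1 := by
    obtain ⟨k, hk, h⟩ := ho
    let b : (Matrix m m ℂ)ˣ := ⟨B, star B, hBs, hsB⟩
    refine ⟨k, hk, ?_⟩
    have := Units.conj_pow b A k
    rw [h] at this
    simpa [b, hBs] using this
  obtain ⟨g, hg, hd⟩ := exists_simultaneous_diagonalization ![A, B * A * star B]
    (by simp [Fin.forall_fin_two, hc, hc.symm]) (by simp [Fin.forall_fin_two, ho, ho'])
  have hd1 := hd 1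
  obtain ⟨d, hd⟩ : ∃ d, A * g = g * diagonal d := hd 0
  obtain ⟨d', hd'⟩ : ∃ d, B * A * star B * g = g * diagonal d := hd1
  have hdd : d = d' := by
    ext j
    by_contra hne
    have hcol : ∀ {X : Matrix m m ℂ} {e : m → ℂ}, X * g = g * diagonal e →
        X *ᵥ g.col j = e j • g.col j := by
      intro X e h
      ext i
      have := congrFun (congrFun h i) j
      simpa [Matrix.mul_apply, mulVec, dotProduct, Matrix.diagonal_apply, mul_comm] using this
    set v := g.col j with hv
    have h1 := hcol hd
    have h2 := hcol hd'
    have h3 : A *ᵥ (star B *ᵥ v) = d' j • (star B *ᵥ v) := by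
      have := congrArg (star B *ᵥ ·) h2
      simpa [mulVec_mulVec, ← mul_assoc, hsB, mulVec_smul] using this
    have horth := dotProduct_eq_zero_of_unitary hA hne h1 h3
    have hv0 : v ≠ 0 := by
      intro h0
      have : g *ᵥ Pi.single j 1 = 0 := by
        simpa [← hv] using h0
      have := (mulVec_injective_of_isUnit hg) (this.trans (mulVec_zero g).symm)
      simpa using congrFun this j
    let x : EuclideanSpace ℂ m := WithLp.toLp 2 v
    let y : EuclideanSpace ℂ m := WithLp.toLp 2 ((star B - 1) *ᵥ v)
    have hx : 0 < ‖x‖ := by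
      rw [norm_pos_iff]
      simpa [x] using hv0
    have hxy : inner ℂ x y = - inner ℂ x x := by
      simp only [x, y, EuclideanSpace.inner_toLp_toLp, sub_mulVec, one_mulVec, sub_dotProduct]
      rw [dotProduct_comm, horth, zero_sub]
    have hcs := norm_inner_le_norm (𝕜 := ℂ) x y
    have hy : ‖y‖ ≤ ‖star B - 1‖ * ‖x‖ := Matrix.l2_opNorm_mulVec _ x
    have hsB1 : ‖star B - 1‖ = ‖B - 1‖ := by rw [← norm_star (B - 1), star_sub, star_one]
    rw [hxy, norm_neg, inner_self_eq_norm_sq_to_K, norm_pow, RCLike.norm_ofReal, abs_norm] at hcs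
    have h4 : ‖x‖ * ‖y‖ ≤ ‖B - 1‖ * (‖x‖ * ‖x‖) := by
      rw [hsB1] at hy
      nlinarith
    nlinarith [mul_pos hx hx]
  have : B * A * star B = A := by
    have hgg : g * g⁻¹ = 1 := mul_nonsing_inv _ ((isUnit_iff_isUnit_det _).1 hg)
    calc B * A * star B = B * A * star B * g * g⁻¹ := by rw [mul_assoc _ g, hgg, mul_one]
      _ = A * g * g⁻¹ := by rw [hd', ← hdd, hd]
      _ = A := by rw [mul_assoc _ g, hgg, mul_one]
  have := congrArg (· * B) this
  simp only [mul_assoc, hsB, mul_one] at this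
  exact this.symm

open scoped Matrix.Norms.L2Operator commutatorElement in
/-- Two elements of a finite group of unitary matrices that are close to `1` commute. -/
theorem commute_of_unitary_of_norm_sub_one_lt {Γ m : Type*} [Group Γ] [Finite Γ] [Fintype m]
    [DecidableEq m] (ρ : Γ →* Matrix m m ℂ) (hU : ∀ γ, ρ γ ∈ unitary (Matrix m m ℂ)) {x y : Γ}
    (hx : ‖ρ x - 1‖ < 1 / 4) (hy : ‖ρ y - 1‖ < 1 / 4) : Commute (ρ x) (ρ y) := by
  have hle : ∀ γ, ‖ρ γ‖ ≤ 1 := fun γ => by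
    nontriviality Matrix m m ℂ
    exact (CStarRing.norm_of_mem_unitary (hU γ)).le
  have hinv : ∀ γ, star (ρ γ) = ρ γ⁻¹ := fun γ => by
    have h : ρ γ * ρ γ⁻¹ = 1 := by rw [← map_mul, mul_inv_cancel, map_one]
    exact left_inv_eq_right_inv (hU γ).1 h
  have hcomm : ∀ b, ‖ρ ⁅x, b⁆ - 1‖ ≤ 1 / 2 * ‖ρ b - 1‖ := by
    intro b
    have h1 : ρ ⁅x, b⁆ - 1 =
        ((ρ x - 1) * (ρ b - 1) - (ρ b - 1) * (ρ x - 1)) * ρ (x⁻¹ * b⁻¹) := by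
      have h2 : ρ ⁅x, b⁆ = ρ x * ρ b * ρ (x⁻¹ * b⁻¹) := by
        rw [← map_mul, ← map_mul, commutatorElement_def]
        simp only [mul_assoc]
      have h3 : ρ b * ρ x * ρ (x⁻¹ * b⁻¹) = 1 := by
        rw [← map_mul, ← map_mul]
        simp [mul_assoc]
      have h4 : (ρ x - 1) * (ρ b - 1) - (ρ b - 1) * (ρ x - 1) = ρ x * ρ b - ρ b * ρ x := by
        noncomm_ring
      rw [h4, sub_mul, ← h2, h3]
    have h5 : ‖(ρ x - 1) * (ρ b - 1) - (ρ b - 1) * (ρ x - 1)‖ ≤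
        ‖ρ x - 1‖ * ‖ρ b - 1‖ + ‖ρ b - 1‖ * ‖ρ x - 1‖ :=
      (norm_sub_le _ _).trans (add_le_add (norm_mul_le _ _) (norm_mul_le _ _))
    have h6 := norm_mul_le ((ρ x - 1) * (ρ b - 1) - (ρ b - 1) * (ρ x - 1)) (ρ (x⁻¹ * b⁻¹))
    rw [← h1] at h6
    have h7 := mul_le_of_le_one_right
      (norm_nonneg ((ρ x - 1) * (ρ b - 1) - (ρ b - 1) * (ρ x - 1))) (hle (x⁻¹ * b⁻¹))
    nlinarith [norm_nonneg (ρ b - 1)]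
  let b : ℕ → Γ := fun k => (fun z => ⁅x, z⁆)^[k] y
  have hb0 : b 0 = y := rfl
  have hbs : ∀ k, b (k + 1) = ⁅x, b k⁆ := fun k => Function.iterate_succ_apply' _ _ _
  clear_value b
  have hanti : Antitone fun k => ‖ρ (b k) - 1‖ := antitone_nat_of_succ_le fun k => by
    rw [hbs]
    linarith [hcomm (b k), norm_nonneg (ρ (b k) - 1)]
  have hlt : ∀ k, ‖ρ (b k) - 1‖ < 1 := fun k => by
    have : ‖ρ (b k) - 1‖ ≤ ‖ρ (b 0) - 1‖ := hanti (Nat.zero_le k)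
    rw [hb0] at this
    linarith
  obtain ⟨k, hk⟩ : ∃ k, ρ (b k) = 1 := by
    obtain ⟨i, j, hij, h⟩ : ∃ i j, i < j ∧ b i = b j := by
      obtain ⟨i, j, hij, h⟩ := Finite.exists_ne_map_eq_of_infinite b
      rcases hij.lt_or_gt with h' | h'
      exacts [⟨i, j, h', h⟩, ⟨j, i, h', h.symm⟩]
    refine ⟨i, ?_⟩
    have h1 : ‖ρ (b j) - 1‖ ≤ ‖ρ (b (i + 1)) - 1‖ := hanti (Nat.succ_le_of_lt hij)
    have h2 := hcomm (b i)
    rw [← hbs] at h2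
    rw [← h] at h1
    exact sub_eq_zero.1 (norm_le_zero_iff.1 (by linarith))
  have hdown : ∀ k, Commute (ρ x) (ρ (b (k + 1))) → Commute (ρ x) (ρ (b k)) := by
    intro k h
    obtain ⟨N, hN, hxN⟩ := isOfFinOrder_iff_pow_eq_one.1 (isOfFinOrder_of_finite x)
    refine commute_of_commute_conj (hU x) (hU (b k)) ⟨N, hN, by rw [← map_pow, hxN, map_one]⟩
      (hlt k) ?_
    rw [hinv, ← map_mul, ← map_mul]
    have h1 : Commute (ρ.toHomUnits x) (ρ.toHomUnits (b (k + 1))) := by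
      rw [Commute, SemiconjBy, Units.ext_iff]
      exact h
    have h2 : Commute (ρ.toHomUnits x) (ρ.toHomUnits (b k * x * (b k)⁻¹)) := by
      have : b k * x * (b k)⁻¹ = (b (k + 1))⁻¹ * x := by
        rw [hbs, commutatorElement_def]
        group
      rw [this, map_mul, map_inv]
      exact h1.inv_right.mul_right (Commute.refl _)
    exact congrArg Units.val h2
  have hall : ∀ j, Commute (ρ x) (ρ (b j)) → Commute (ρ x) (ρ (b 0)) := by
    intro j
    induction j with
    | zero => exact id
    | succ j ih => exact fun h => ih (hdown j h)
  rw [← hb0]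
  exact hall k (by rw [hk]; exact Commute.one_right _)

open scoped Matrix.Norms.L2Operator in
/-- A set of pairwise separated unitary matrices has uniformly bounded cardinality. -/
theorem exists_card_le_of_separated_unitary (m : Type*) [Fintype m] [DecidableEq m] {ε : ℝ}
    (hε : 0 < ε) :
    ∃ N : ℕ, ∀ (ι : Type) [Fintype ι] (f : ι → Matrix m m ℂ),
      (∀ i, f i ∈ unitary (Matrix m m ℂ)) → (∀ i j, i ≠ j → ε ≤ ‖f i - f j‖) →
      Fintype.card ι ≤ N := by
  have : ProperSpace (Matrix m m ℂ) := FiniteDimensional.proper ℂ _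
  obtain ⟨t, ht, hcov⟩ := Metric.totallyBounded_iff.1
    (isCompact_closedBall (0 : Matrix m m ℂ) 1).totallyBounded (ε / 2) (half_pos hε)
  have := ht.fintype
  refine ⟨Fintype.card t, fun ι _ f hf hsep => ?_⟩
  have hex : ∀ i, ∃ c : t, dist (f i) c < ε / 2 := by
    intro i
    have hi : f i ∈ Metric.closedBall (0 : Matrix m m ℂ) 1 := by
      rw [mem_closedBall_zero_iff]
      nontriviality Matrix m m ℂ
      exact (CStarRing.norm_of_mem_unitary (hf i)).le
    obtain ⟨c, hc, h⟩ := Set.mem_iUnion₂.1 (hcov hi)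
    exact ⟨⟨c, hc⟩, h⟩
  choose c hc using hex
  refine Fintype.card_le_of_injective c fun i j hij => ?_
  by_contra hne
  have h1 := hsep i j hne
  have h2 := dist_triangle_right (f i) (f j) (c i)
  have h3 := hc j
  rw [← hij] at h3
  rw [← dist_eq_norm] at h1
  linarith [hc i]

/-- The eigenvalues of a matrix all lie in the open disc of radius `1 / 4` around `1`. -/
def EigenvaluesNearOne {m : Type*} [Fintype m] [DecidableEq m] (A : Matrix m m ℂ) : Prop :=
  ∀ z ∈ spectrum ℂ A, ‖z - 1‖ < 1 / 4

theorem EigenvaluesNearOne.conj {m : Type*} [Fintype m] [DecidableEq m] {A : Matrix m m ℂ}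
    (h : EigenvaluesNearOne A) (s : (Matrix m m ℂ)ˣ) :
    EigenvaluesNearOne ((s : Matrix m m ℂ) * A * (↑s⁻¹ : Matrix m m ℂ)) := by
  intro z hz
  rw [spectrum.units_conjugate] at hz
  exact h z hz

/-- Conjugation of a matrix representation by an invertible matrix. -/
def conjRep {Γ m : Type*} [Group Γ] [Fintype m] [DecidableEq m] (ρ : Γ →* Matrix m m ℂ)
    (s : (Matrix m m ℂ)ˣ) : Γ →* Matrix m m ℂ where
  toFun γ := (s : Matrix m m ℂ) * ρ γ * (↑s⁻¹ : Matrix m m ℂ)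
  map_one' := by simp
  map_mul' a b := by simp [mul_assoc]

open scoped Matrix.Norms.L2Operator in
theorem commute_of_eigenvaluesNearOne {Γ m : Type*} [Group Γ] [Finite Γ] [Fintype m]
    [DecidableEq m] (ρ : Γ →* Matrix m m ℂ) {x y : Γ} (hx : EigenvaluesNearOne (ρ x))
    (hy : EigenvaluesNearOne (ρ y)) : Commute (ρ x) (ρ y) := by
  obtain ⟨s, hs⟩ := exists_unitary_conj ρ
  have h : Commute (conjRep ρ s x) (conjRep ρ s y) :=
    commute_of_unitary_of_norm_sub_one_lt (conjRep ρ s) hs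
      (norm_sub_one_lt_of_unitary (hs x) (by norm_num) (hx.conj s))
      (norm_sub_one_lt_of_unitary (hs y) (by norm_num) (hy.conj s))
  have h' : (s : Matrix m m ℂ) * ρ (x * y) * (↑s⁻¹ : Matrix m m ℂ) =
      (s : Matrix m m ℂ) * ρ (y * x) * (↑s⁻¹ : Matrix m m ℂ) := by
    have : conjRep ρ s (x * y) = conjRep ρ s (y * x) := by
      rw [map_mul, map_mul]; exact h
    exact this
  rw [Units.mul_left_inj, Units.mul_right_inj, map_mul, map_mul] at h'
  exact h'

open scoped Matrix.Norms.L2Operator in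
/-- Jordan and Schur: a locally finite group of complex matrices has a normal subgroup of finite index
whose elements commute. -/
theorem exists_normal_finiteIndex_commute {G m : Type*} [Group G] [Fintype m] [DecidableEq m]
    (ρ : G →* Matrix m m ℂ) (hfin : ∀ s : Set G, s.Finite → Finite (Subgroup.closure s)) :
    ∃ H : Subgroup G, H.Normal ∧ H.FiniteIndex ∧ ∀ a ∈ H, ∀ b ∈ H, Commute (ρ a) (ρ b) := by
  let X : Set G := {g | EigenvaluesNearOne (ρ g)}
  have hX : ∀ a ∈ X, ∀ b ∈ X, Commute (ρ a) (ρ b) := by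
    intro a ha b hb
    have := hfin {a, b} (Set.toFinite _)
    exact commute_of_eigenvaluesNearOne (ρ.comp (Subgroup.closure {a, b}).subtype)
      (x := ⟨a, Subgroup.subset_closure (by simp)⟩) (y := ⟨b, Subgroup.subset_closure (by simp)⟩)
      ha hb
  refine ⟨Subgroup.closure X, ?_, ?_, ?_⟩
  · have : Subgroup.closure X = Subgroup.normalClosure X := by
      refine le_antisymm Subgroup.closure_le_normalClosure ?_
      rw [Subgroup.normalClosure]
      refine Subgroup.closure_mono fun g hg => ?_
      obtain ⟨a, ha, hg⟩ := Group.mem_conjugatesOfSet_iff.1 hg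
      obtain ⟨c, rfl⟩ := isConj_iff.1 hg
      have := EigenvaluesNearOne.conj ha (ρ.toHomUnits c)
      rw [← map_inv] at this
      change EigenvaluesNearOne (ρ (c * a * c⁻¹))
      rw [map_mul, map_mul]
      exact this
    rw [this]
    infer_instance
  · rw [Subgroup.finiteIndex_iff_finite_quotient]
    by_contra hinf
    rw [not_finite_iff_infinite] at hinf
    obtain ⟨N, hN⟩ := exists_card_le_of_separated_unitary m (ε := 1 / 4) (by norm_num)
    obtain ⟨e⟩ : Nonempty (Fin (N + 1) ↪ G ⧸ Subgroup.closure X) :=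
      ⟨(Fin.valEmbedding).trans (Infinite.natEmbedding _)⟩
    let r : Fin (N + 1) → G := fun i => (e i).out
    have := hfin (Set.range r) (Set.finite_range r)
    let ρ' := ρ.comp (Subgroup.closure (Set.range r)).subtype
    obtain ⟨s, hs⟩ := exists_unitary_conj ρ'
    let r' : Fin (N + 1) → Subgroup.closure (Set.range r) :=
      fun i => ⟨r i, Subgroup.subset_closure ⟨i, rfl⟩⟩
    have hcard := hN (Fin (N + 1)) (fun i => conjRep ρ' s (r' i)) (fun i => hs _) (by
      intro i j hij
      by_contra! hlt
      apply hij
      apply e.injective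
      rw [← (e i).out_eq', ← (e j).out_eq']
      refine QuotientGroup.eq.2 (Subgroup.subset_closure fun z hz => ?_)
      have hz' : z ∈ spectrum ℂ (conjRep ρ' s ((r' i)⁻¹ * r' j)) := by
        change z ∈ spectrum ℂ ((s : Matrix m m ℂ) * _ * (↑s⁻¹ : Matrix m m ℂ))
        rw [spectrum.units_conjugate]
        exact hz
      have hsub : conjRep ρ' s ((r' i)⁻¹ * r' j) - 1 =
          conjRep ρ' s (r' i)⁻¹ * (conjRep ρ' s (r' j) - conjRep ρ' s (r' i)) := by
        rw [mul_sub, ← map_mul, ← map_mul, inv_mul_cancel, map_one]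
      have : Nontrivial (Matrix m m ℂ) := by
        by_contra hn
        rw [not_nontrivial_iff_subsingleton] at hn
        simp [spectrum.of_subsingleton] at hz
      have h1 : ‖conjRep ρ' s (r' i)⁻¹‖ = 1 := CStarRing.norm_of_mem_unitary (hs _)
      have h2 := norm_mul_le (conjRep ρ' s (r' i)⁻¹) (conjRep ρ' s (r' j) - conjRep ρ' s (r' i))
      rw [← hsub, h1, one_mul, norm_sub_rev (conjRep ρ' s (r' j))] at h2
      refine lt_of_le_of_lt (spectrum.norm_le_norm_of_mem ?_) (h2.trans_lt hlt)
      have h3 := (spectrum.add_mem_iff (R := ℂ) (r := z - 1) (s := 1)).1 (by rwa [sub_add_cancel])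
      rwa [map_one, neg_add_eq_sub] at h3)
    simp at hcard
  · intro a ha b hb
    have hle : ∀ y : G, (∀ x ∈ X, Commute (ρ x) (ρ y)) → ∀ x ∈ Subgroup.closure X,
        Commute (ρ x) (ρ y) := by
      intro y hy x hx
      have : Subgroup.closure X ≤
          (Subgroup.centralizer {ρ.toHomUnits y}).comap ρ.toHomUnits := by
        rw [Subgroup.closure_le]
        intro x hx
        simpa [Subgroup.mem_centralizer_singleton_iff, Units.ext_iff] using (hy x hx).eq
      have h := this hx
      simpa [Subgroup.mem_centralizer_singleton_iff, Units.ext_iff, Commute, SemiconjBy] using h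
    exact hle b (fun x hx => (hle x (fun y hy => hX y hy x hx) b hb).symm) a ha

/-- A finitely generated group of matrices over an algebraic extension of a finite field is
finite. -/
theorem finite_closure_of_injective_matrix {F k Γ m : Type*} [Field F] [Finite F] [Field k]
    [Algebra F k] [Algebra.IsAlgebraic F k] [Group Γ] [Fintype m] [DecidableEq m]
    (f : Γ →* Matrix m m k) (hf : Function.Injective f) (s : Set Γ) (hs : s.Finite) :
    Finite (Subgroup.closure s) := by
  let E : Set k := (fun x : Γ × m × m => f x.1 x.2.1 x.2.2) '' (s ×ˢ Set.univ) ∪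
    (fun x : Γ × m × m => f x.1⁻¹ x.2.1 x.2.2) '' (s ×ˢ Set.univ)
  have hE : E.Finite :=
    ((hs.prod Set.finite_univ).image _).union ((hs.prod Set.finite_univ).image _)
  let A := Algebra.adjoin F E
  have hfin : Module.Finite F A := Module.Finite.iff_fg.2
    (fg_adjoin_of_finite hE fun x _ => Algebra.IsIntegral.isIntegral x)
  have : Finite A := Module.finite_of_finite F
  have hmul : ∀ M N : Matrix m m k, (∀ i j, M i j ∈ A) → (∀ i j, N i j ∈ A) →
      ∀ i j, (M * N) i j ∈ A := fun M N hM hN i j =>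
    A.sum_mem fun l _ => A.mul_mem (hM i l) (hN l j)
  have hcl : ∀ x ∈ Subgroup.closure s, (∀ i j, f x i j ∈ A) ∧ ∀ i j, f x⁻¹ i j ∈ A := by
    intro x hx
    induction hx using Subgroup.closure_induction with
    | mem x hx =>
      exact ⟨fun i j => Algebra.subset_adjoin (Or.inl ⟨(x, i, j), ⟨hx, trivial⟩, rfl⟩),
        fun i j => Algebra.subset_adjoin (Or.inr ⟨(x, i, j), ⟨hx, trivial⟩, rfl⟩)⟩
    | one =>
      have h1 : ∀ i j, (1 : Matrix m m k) i j ∈ A := fun i j => by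
        rw [Matrix.one_apply]
        split_ifs
        exacts [A.one_mem, A.zero_mem]
      simpa using h1
    | mul x y _ _ hx hy =>
      rw [_root_.mul_inv_rev, map_mul, map_mul]
      exact ⟨hmul _ _ hx.1 hy.1, hmul _ _ hy.2 hx.2⟩
    | inv x _ hx => exact ⟨hx.2, by simpa using hx.1⟩
  refine Finite.of_injective (β := m → m → A)
    (fun x i j => ⟨f x i j, (hcl x x.2).1 i j⟩) fun x y h => ?_
  refine Subtype.ext (hf ?_)
  ext i j
  exact congrArg Subtype.val (congrFun (congrFun h i) j)

theorem charZero_wittVector (p : ℕ) [Fact p.Prime] : CharZero (Rp p) := by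
  obtain ⟨q, hq⟩ := CharP.exists (Rp p)
  rcases CharP.char_is_prime_or_zero (Rp p) q with hq' | rfl
  · have h : ((q : ℕ) : AlgebraicClosure (ZMod p)) = 0 := by
      rw [← map_natCast (WittVector.constantCoeff (p := p)), CharP.cast_eq_zero, map_zero]
    rw [CharP.cast_eq_zero_iff _ p, Nat.prime_dvd_prime_iff_eq Fact.out hq'] at h
    subst h
    exact absurd (CharP.cast_eq_zero (Rp p) p) (WittVector.p_nonzero p _)
  · exact CharP.charP_to_charZero _

/-- The algebraic closure of the fraction field of `W(𝔽̄_p)` is abstractly isomorphic to `ℂ`. -/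
theorem nonempty_ringEquiv_complex (p : ℕ) [Fact p.Prime] : Nonempty (Kap p ≃+* ℂ) := by
  have : CharZero (Rp p) := charZero_wittVector p
  have : CharZero (Kap p) := charZero_of_injective_ringHom (f := toKap p)
    ((algebraMap (Kp p) (Kap p)).injective.comp (IsFractionRing.injective (Rp p) (Kp p)))
  have hk : Cardinal.mk (AlgebraicClosure (ZMod p)) = Cardinal.aleph0 := by
    refine le_antisymm ?_ (Cardinal.aleph0_le_mk _)
    refine (Algebra.IsAlgebraic.cardinalMk_le_max (ZMod p) _).trans ?_
    simp
  have hR : Cardinal.mk (Rp p) = Cardinal.continuum := by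
    rw [Cardinal.mk_congr (⟨WittVector.coeff, WittVector.mk p, fun _ => rfl, fun _ => rfl⟩ :
      Rp p ≃ (ℕ → AlgebraicClosure (ZMod p)))]
    simp [hk]
  have hK : Cardinal.mk (Kap p) = Cardinal.continuum := by
    refine le_antisymm ?_ ?_
    · refine (Algebra.IsAlgebraic.cardinalMk_le_max (Kp p) _).trans ?_
      have := IsLocalization.cardinalMk_le (L := Kp p) (nonZeroDivisors (Rp p))
      rw [hR] at this
      exact max_le this Cardinal.aleph0_le_continuum
    · rw [← hR]
      exact Cardinal.mk_le_of_injective (f := toKap p)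
        ((algebraMap (Kp p) (Kap p)).injective.comp (IsFractionRing.injective (Rp p) (Kp p)))
  refine IsAlgClosed.ringEquiv_of_equiv_of_charZero ?_ ?_
  · rw [hK]; exact Cardinal.aleph0_lt_continuum
  · exact Cardinal.eq.1 (hK.trans Cardinal.mk_complex.symm)

section Witt

variable {p : ℕ} [Fact p.Prime] {n : ℕ}

theorem p_dvd_iff_constantCoeff_eq_zero (x : Rp p) :
    (p : Rp p) ∣ x ↔ WittVector.constantCoeff x = 0 := by
  rw [← Ideal.mem_span_singleton, ← WittVector.ker_constantCoeff, RingHom.mem_ker]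

theorem eq_zero_of_forall_p_pow_dvd {x : Rp p} (h : ∀ r : ℕ, (p : Rp p) ^ r ∣ x) : x = 0 := by
  ext i
  obtain ⟨y, rfl⟩ := h (i + 1)
  rw [mul_comm, WittVector.mul_pow_charP_coeff_zero _ (Nat.lt_succ_self i), WittVector.zero_coeff]

theorem p_pow_dvd_of_dvd_frobW {x : Rp p} {r : ℕ} (h : (p : Rp p) ^ r ∣ frobW p x) :
    (p : Rp p) ^ r ∣ x := by
  let e := WittVector.frobeniusEquiv p (AlgebraicClosure (ZMod p))
  have h1 := map_dvd e.symm h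
  have h2 : e.symm (frobW p x) = x := e.symm_apply_apply x
  rwa [h2, map_pow, map_natCast] at h1

theorem p_pow_succ_dvd_pow_sub_pow {a b : Rp p} {r : ℕ} (hr : 1 ≤ r)
    (h : (p : Rp p) ^ r ∣ a - b) : (p : Rp p) ^ (r + 1) ∣ a ^ p - b ^ p := by
  rw [← (Commute.all a b).geom_sum₂_mul, pow_succ']
  exact mul_dvd_mul (dvd_geom_sum₂_self ((dvd_pow_self _ (by omega)).trans h)) h

theorem dvd_mul_apply {m R : Type*} [Fintype m] [CommRing R] {r : R} (M : Matrix m m R)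
    {N : Matrix m m R} (h : ∀ i j, r ∣ N i j) (i j : m) : r ∣ (M * N) i j :=
  Finset.dvd_sum fun l _ => (h l j).mul_left _

theorem isUnit_map_pow {u : Matrix (Fin n) (Fin n) (Rp p)} (hu : IsUnit u) :
    IsUnit (u.map (· ^ p)) := by
  rw [isUnit_iff_isUnit_det] at hu ⊢
  apply WittVector.isUnit_of_coeff_zero_ne_zero
  change WittVector.constantCoeff _ ≠ 0
  have h : (WittVector.constantCoeff.mapMatrix (u.map (· ^ p))) =
      (frobenius (AlgebraicClosure (ZMod p)) p).mapMatrix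
        (WittVector.constantCoeff.mapMatrix u) := by
    ext i j
    exact map_pow WittVector.constantCoeff (u i j) p
  rw [RingHom.map_det, h, ← RingHom.map_det, ← RingHom.map_det]
  exact ((hu.map WittVector.constantCoeff).map _).ne_zero

/-- A solution `c` of `u^(p) · φ(c) = (u c)^(p)` that reduces to `1` modulo `p` equals `1`. -/
theorem eq_one_of_map_constantCoeff_eq_one {u c : Matrix (Fin n) (Fin n) (Rp p)} (hu : IsUnit u)
    (hc : u.map (· ^ p) * c.map (frobW p) = (u * c).map (· ^ p))
    (h1 : c.map (WittVector.constantCoeff (p := p)) = 1) : c = 1 := by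
  have hdvd : ∀ r : ℕ, ∀ i j, (p : Rp p) ^ (r + 1) ∣ (c - 1) i j := by
    intro r
    induction r with
    | zero =>
      intro i j
      rw [zero_add, pow_one, p_dvd_iff_constantCoeff_eq_zero]
      have := congrFun (congrFun h1 i) j
      simp only [Matrix.map_apply] at this
      rw [Matrix.sub_apply, map_sub, this, Matrix.one_apply, Matrix.one_apply]
      split_ifs <;> simp
    | succ r ih =>
      intro i j
      have h2 : u.map (· ^ p) * (c - 1).map (frobW p) = (u * c).map (· ^ p) - u.map (· ^ p) := by
        have : (c - 1).map (frobW p) = c.map (frobW p) - 1 := by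
          rw [Matrix.map_sub _ (map_sub _), Matrix.map_one _ (map_zero _) (map_one _)]
        rw [this, mul_sub, hc, mul_one]
      have h3 : ∀ i j, (p : Rp p) ^ (r + 1 + 1) ∣ (u.map (· ^ p) * (c - 1).map (frobW p)) i j := by
        intro i j
        rw [h2]
        refine p_pow_succ_dvd_pow_sub_pow (Nat.succ_pos r) ?_
        have : (u * c) i j - u i j = (u * (c - 1)) i j := by
          rw [mul_sub, mul_one, Matrix.sub_apply]
        rw [this]
        exact dvd_mul_apply _ ih i j
      have h4 := dvd_mul_apply (u.map (· ^ p))⁻¹ h3 i j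
      rw [nonsing_inv_mul_cancel_left _ _ ((isUnit_iff_isUnit_det _).1 (isUnit_map_pow hu))] at h4
      exact p_pow_dvd_of_dvd_frobW h4
  rw [← sub_eq_zero]
  ext i j
  rw [eq_zero_of_forall_p_pow_dvd fun r => (pow_dvd_pow _ (Nat.le_succ r)).trans (hdvd r i j)]
  rfl

end Witt

section Galois

variable {p : ℕ} [Fact p.Prime] {n : ℕ} {δ : Rp p → Rp p} {O : Subring (Rp p)}
  {u : Matrix (Fin n) (Fin n) (Rp p)}

theorem subring_le_genBy (O : Subring (Rp p)) (u : Matrix (Fin n) (Fin n) (Rp p)) :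
    O ≤ genBy O u :=
  fun _ hx => Subring.subset_closure (Or.inl hx)

theorem mul_apply_mem {c d : Matrix (Fin n) (Fin n) (Rp p)} (hc : ∀ i j, c i j ∈ O)
    (hd : ∀ i j, d i j ∈ O) (i j : Fin n) : (c * d) i j ∈ O := by
  rw [Matrix.mul_apply]
  exact O.sum_mem fun l _ => O.mul_mem (hc i l) (hd l j)

/-- Elements of the `δ`-Galois group preserve the differential equation satisfied by `u`. -/
theorem map_mul_eq_of_mem_galoisGroup {α c : Matrix (Fin n) (Fin n) (Rp p)}
    (hα : ∀ i j, α i j ∈ O) (hαu : u.map δ = α * u.map (· ^ p)) (hc : c ∈ galoisGroup δ O u) :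
    (u * c).map δ = α * (u * c).map (· ^ p) := by
  obtain ⟨_, _, σ, hσO, hσδ, hσu⟩ := hc
  let τ : genBy O u →+* Rp p := (genBy O u).subtype.comp σ.toRingHom
  ext1 i j
  have hx : ∀ l, u l j ∈ genBy O u := fun l => mem_genBy O u l j
  have ha : ∀ l, α i l ∈ genBy O u := fun l => subring_le_genBy O u (hα i l)
  let y : genBy O u := ∑ l, (⟨α i l, ha l⟩ * ⟨u l j, hx l⟩ ^ p : genBy O u)
  have hy : (y : Rp p) = δ (u i j) := by
    have := congrFun (congrFun hαu i) j
    simp only [Matrix.map_apply, Matrix.mul_apply] at this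
    simp [y, this]
  have h1 : τ y = δ ((u * c) i j) := by
    have h := hσδ ⟨u i j, mem_genBy O u i j⟩ y hy
    rw [hσu] at h
    exact h
  have h2 : τ y = ∑ l, τ (⟨α i l, ha l⟩ * ⟨u l j, hx l⟩ ^ p) := map_sum τ _ _
  rw [Matrix.map_apply, ← h1, Matrix.mul_apply, h2]
  refine Finset.sum_congr rfl fun l _ => ?_
  rw [map_mul, map_pow]
  congr 1
  · exact hσO ⟨α i l, ha l⟩ (hα i l)
  · exact congrArg (· ^ p) (hσu l j)

/-- The ring `O[u]` is stable under `δ`. -/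
theorem delta_mem_genBy (hp2 : p ≠ 2) (hδ : ∀ a, frobW p a = a ^ p + p * δ a)
    (hO : ∀ x ∈ O, δ x ∈ O) {α : Matrix (Fin n) (Fin n) (Rp p)} (hα : ∀ i j, α i j ∈ O)
    (hαu : u.map δ = α * u.map (· ^ p)) : ∀ x ∈ genBy O u, δ x ∈ genBy O u := by
  have hp : p.Prime := Fact.out
  have hp0 : (p : Rp p) ≠ 0 := WittVector.p_nonzero p _
  intro x hx
  refine (Subring.closure_induction (p := fun x _ => x ∈ genBy O u ∧ δ x ∈ genBy O u)
    ?_ ?_ ?_ ?_ ?_ ?_ hx).2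
  · rintro x (hx | ⟨i, j, rfl⟩)
    · exact ⟨subring_le_genBy O u hx, subring_le_genBy O u (hO x hx)⟩
    · refine ⟨mem_genBy O u i j, ?_⟩
      have h := congrFun (congrFun hαu i) j
      rw [Matrix.map_apply] at h
      rw [h]
      exact mul_apply_mem (fun k l => subring_le_genBy O u (hα k l))
        (fun k l => (genBy O u).pow_mem (mem_genBy O u k l) p) i j
  · exact ⟨(genBy O u).zero_mem, subring_le_genBy O u (hO 0 O.zero_mem)⟩
  · exact ⟨(genBy O u).one_mem, subring_le_genBy O u (hO 1 O.one_mem)⟩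
  · rintro x y _ _ ⟨hx, hx'⟩ ⟨hy, hy'⟩
    refine ⟨(genBy O u).add_mem hx hy, ?_⟩
    obtain ⟨r, hr⟩ := exists_add_pow_prime_eq hp (⟨x, hx⟩ : genBy O u) ⟨y, hy⟩
    replace hr : (x + y) ^ p = x ^ p + y ^ p + p * x * y * r := by
      simpa using congrArg Subtype.val hr
    have h : δ (x + y) = δ x + δ y - x * y * r := by
      apply mul_left_cancel₀ hp0
      have h1 := hδ (x + y)
      rw [map_add, hδ, hδ, hr] at h1
      linear_combination -h1
    rw [h]
    exact (genBy O u).sub_mem ((genBy O u).add_mem hx' hy')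
      ((genBy O u).mul_mem ((genBy O u).mul_mem hx hy) r.2)
  · rintro x _ ⟨hx, hx'⟩
    refine ⟨(genBy O u).neg_mem hx, ?_⟩
    have h : δ (-x) = -δ x := by
      apply mul_left_cancel₀ hp0
      have h1 := hδ (-x)
      rw [map_neg, hδ, (hp.odd_of_ne_two hp2).neg_pow] at h1
      linear_combination -h1
    rw [h]
    exact (genBy O u).neg_mem hx'
  · rintro x y _ _ ⟨hx, hx'⟩ ⟨hy, hy'⟩
    refine ⟨(genBy O u).mul_mem hx hy, ?_⟩
    have h : δ (x * y) = x ^ p * δ y + y ^ p * δ x + p * (δ x * δ y) := by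
      apply mul_left_cancel₀ hp0
      have h1 := hδ (x * y)
      rw [map_mul, hδ, hδ, mul_pow] at h1
      linear_combination -h1
    rw [h]
    exact (genBy O u).add_mem ((genBy O u).add_mem
      ((genBy O u).mul_mem ((genBy O u).pow_mem hx p) hy')
      ((genBy O u).mul_mem ((genBy O u).pow_mem hy p) hx'))
      ((genBy O u).mul_mem (natCast_mem _ p) ((genBy O u).mul_mem hx' hy'))

theorem map_frobW_eq (hδ : ∀ a, frobW p a = a ^ p + p * δ a)
    {α v : Matrix (Fin n) (Fin n) (Rp p)} (hv : v.map δ = α * v.map (· ^ p)) :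
    v.map (frobW p) = (1 + (p : Rp p) • α) * v.map (· ^ p) := by
  rw [add_mul, one_mul, Matrix.smul_mul, ← hv]
  ext1 i j
  simp [hδ]

theorem map_delta_eq (hu : IsUnit u) :
    u.map δ = (u.map δ) * (u.map (· ^ p))⁻¹ * u.map (· ^ p) := by
  rw [nonsing_inv_mul_cancel_right _ _ ((isUnit_iff_isUnit_det _).1 (isUnit_map_pow hu))]

theorem map_pow_mul_map_frobW (hδ : ∀ a, frobW p a = a ^ p + p * δ a) (hu : IsUnit u)
    (hα : ∀ i j, ((u.map δ) * (u.map (· ^ p))⁻¹) i j ∈ O) {c : Matrix (Fin n) (Fin n) (Rp p)}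
    (hc : c ∈ galoisGroup δ O u) :
    u.map (· ^ p) * c.map (frobW p) = (u * c).map (· ^ p) := by
  set α := (u.map δ) * (u.map (· ^ p))⁻¹ with hαdef
  have hαu : u.map δ = α * u.map (· ^ p) := map_delta_eq hu
  have h1 := map_frobW_eq hδ hαu
  have h2 := map_frobW_eq hδ (map_mul_eq_of_mem_galoisGroup hα hαu hc)
  rw [Matrix.map_mul, h1, mul_assoc] at h2
  have h3 : IsUnit (1 + (p : Rp p) • α) := by
    rw [isUnit_iff_isUnit_det] at hu ⊢
    have h4 : IsUnit (u.map (frobW p)).det := by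
      have := hu.map (frobW p)
      rwa [RingHom.map_det] at this
    rw [h1, det_mul] at h4
    exact isUnit_of_mul_isUnit_left h4
  exact h3.mul_left_cancel h2

theorem one_mem_galoisGroup : (1 : Matrix (Fin n) (Fin n) (Rp p)) ∈ galoisGroup δ O u := by
  have h1 : ∀ i j, (1 : Matrix (Fin n) (Fin n) (Rp p)) i j ∈ O := fun i j => by
    rw [Matrix.one_apply]
    split_ifs
    exacts [O.one_mem, O.zero_mem]
  exact ⟨h1, ⟨1, mul_one 1, mul_one 1, h1⟩, RingEquiv.refl _, fun _ _ => rfl, fun _ _ h => h,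
    fun i j => by rw [mul_one]; rfl⟩

/-- An automorphism fixing `O` with `σ(u) = u * c` satisfies `σ(u * d) = u * c * d` for `d` with
entries in `O`. -/
theorem galois_apply_mul {c d : Matrix (Fin n) (Fin n) (Rp p)} (hd : ∀ i j, d i j ∈ O)
    {σ : genBy O u ≃+* genBy O u}
    (hσO : ∀ x : genBy O u, (x : Rp p) ∈ O → (σ x : Rp p) = x)
    (hσu : ∀ i j, (σ ⟨u i j, mem_genBy O u i j⟩ : Rp p) = (u * c) i j) (i j : Fin n)
    (x : genBy O u) (hx : (x : Rp p) = (u * d) i j) : (σ x : Rp p) = (u * c * d) i j := by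
  have hm : ∀ l, d l j ∈ genBy O u := fun l => subring_le_genBy O u (hd l j)
  have hx' : x = ∑ l, ⟨u i l, mem_genBy O u i l⟩ * ⟨d l j, hm l⟩ := by
    apply Subtype.ext
    rw [hx, Matrix.mul_apply]
    simp
  rw [hx', map_sum, Matrix.mul_apply, AddSubmonoidClass.coe_finsetSum]
  refine Finset.sum_congr rfl fun l _ => ?_
  rw [map_mul, Subring.coe_mul, hσu, hσO _ (hd l j)]

theorem mul_mem_galoisGroup {c c' : Matrix (Fin n) (Fin n) (Rp p)} (hc : c ∈ galoisGroup δ O u)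
    (hc' : c' ∈ galoisGroup δ O u) : c * c' ∈ galoisGroup δ O u := by
  obtain ⟨hcO, ⟨d, hcd, hdc, hdO⟩, σ, hσO, hσδ, hσu⟩ := hc
  obtain ⟨hcO', ⟨d', hcd', hdc', hdO'⟩, σ', hσO', hσδ', hσu'⟩ := hc'
  refine ⟨mul_apply_mem hcO hcO', ⟨d' * d, ?_, ?_, mul_apply_mem hdO' hdO⟩, σ'.trans σ, ?_, ?_, ?_⟩
  · rw [mul_assoc, ← mul_assoc c', hcd', one_mul, hcd]
  · rw [mul_assoc, ← mul_assoc d, hdc, one_mul, hdc']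
  · intro x hx
    have h := hσO' x hx
    rw [RingEquiv.trans_apply, hσO _ (by rwa [h]), h]
  · intro x y h
    exact hσδ _ _ (hσδ' x y h)
  · intro i j
    rw [← mul_assoc]
    exact galois_apply_mul hcO' hσO hσu i j _ (hσu' i j)

theorem inv_mem_galoisGroup {c d : Matrix (Fin n) (Fin n) (Rp p)} (hc : c ∈ galoisGroup δ O u)
    (hcd : c * d = 1) (hst : ∀ x ∈ genBy O u, δ x ∈ genBy O u) : d ∈ galoisGroup δ O u := by
  obtain ⟨hcO, ⟨d', hcd', hdc', hdO⟩, σ, hσO, hσδ, hσu⟩ := hc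
  obtain rfl : d' = d := left_inv_eq_right_inv hdc' hcd
  have hfix : ∀ x : genBy O u, (x : Rp p) ∈ O → σ.symm x = x := fun x hx => by
    rw [RingEquiv.symm_apply_eq]
    exact Subtype.ext (hσO x hx).symm
  refine ⟨hdO, ⟨c, hdc', hcd, hcO⟩, σ.symm, fun x hx => by rw [hfix x hx], ?_, ?_⟩
  · intro x y h
    have hz := hσδ (σ.symm x) ⟨_, hst _ (σ.symm x).2⟩ rfl
    rw [RingEquiv.apply_symm_apply, ← h] at hz
    rw [← Subtype.ext hz, RingEquiv.symm_apply_apply]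
  · intro i j
    have hm : (u * d') i j ∈ genBy O u :=
      mul_apply_mem (mem_genBy O u) (fun l m => subring_le_genBy O u (hdO l m)) i j
    have h := galois_apply_mul hdO hσO hσu i j ⟨_, hm⟩ rfl
    rw [mul_assoc, hcd, mul_one] at h
    have h' : σ ⟨_, hm⟩ = ⟨u i j, mem_genBy O u i j⟩ := Subtype.ext h
    rw [← h', RingEquiv.symm_apply_apply]

/-- The `δ`-Galois group as a subgroup of `GL_n(R)`. -/
def galoisSubgroup (δ : Rp p → Rp p) (O : Subring (Rp p)) (u : Matrix (Fin n) (Fin n) (Rp p))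
    (hst : ∀ x ∈ genBy O u, δ x ∈ genBy O u) : Subgroup (Matrix (Fin n) (Fin n) (Rp p))ˣ where
  carrier := {c | (c : Matrix (Fin n) (Fin n) (Rp p)) ∈ galoisGroup δ O u}
  one_mem' := one_mem_galoisGroup
  mul_mem' ha hb := mul_mem_galoisGroup ha hb
  inv_mem' {c} hc := inv_mem_galoisGroup hc c.mul_inv hst

/-- The `δ`-Galois group is locally finite: it embeds by reduction modulo `p` into the general
linear group over the algebraic closure of the prime field. -/
theorem finite_closure_galoisSubgroup (hδ : ∀ a, frobW p a = a ^ p + p * δ a)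
    (hu : IsUnit u) (hα : ∀ i j, ((u.map δ) * (u.map (· ^ p))⁻¹) i j ∈ O)
    (hst : ∀ x ∈ genBy O u, δ x ∈ genBy O u) (s : Set (galoisSubgroup δ O u hst))
    (hs : s.Finite) : Finite (Subgroup.closure s) := by
  let f : galoisSubgroup δ O u hst →* Matrix (Fin n) (Fin n) (AlgebraicClosure (ZMod p)) :=
    ((WittVector.constantCoeff : Rp p →+* _).mapMatrix.toMonoidHom.comp (Units.coeHom _)).comp
      (galoisSubgroup δ O u hst).subtype
  have hker : ∀ a, f a = 1 → a = 1 := fun a ha =>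
    Subtype.ext <| Units.ext <|
      eq_one_of_map_constantCoeff_eq_one hu (map_pow_mul_map_frobW hδ hu hα a.2) ha
  have hf : Function.Injective f := fun a b hab => by
    rw [← mul_inv_eq_one]
    apply hker
    rw [map_mul, hab, ← map_mul, mul_inv_cancel, map_one]
  exact finite_closure_of_injective_matrix (F := ZMod p) f hf s hs

end Galois

/-- Zariski-generically in `u`, the `δ`-Galois group `G_{u/O}` (for
`α := δu·(u^(p))⁻¹` and any valuation `δ`-subring `O` containing the entries of `α`)
contains a normal subgroup of finite index which is diagonalizable over `K^a`. -/
theorem statement18 {p : ℕ} [Fact p.Prime] (hp2 : p ≠ 2)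
    (δ : Rp p → Rp p) (hδ : ∀ a, frobW p a = a ^ p + p * δ a)
    (n : ℕ) (hn : 1 ≤ n) :
    ∃ S : Set (MvPolynomial (Fin n × Fin n) (Kp p)),
      (∃ f ∈ S, MvPolynomial.eval
          (fun ij => if ij.1 = ij.2 then (1 : Kp p) else 0) f ≠ 0) ∧
      ∀ u : Matrix (Fin n) (Fin n) (Rp p), IsUnit u →
        (∃ f ∈ S, MvPolynomial.eval
            (fun ij => algebraMap (Rp p) (Kp p) (u ij.1 ij.2)) f ≠ 0) →
        ∀ O : Subring (Rp p), (∀ x ∈ O, δ x ∈ O) →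
          (∃ F : Subfield (Kp p),
            O = (F.toSubring).comap (algebraMap (Rp p) (Kp p))) →
          (∀ i j, ((u.map δ) * (u.map (· ^ p))⁻¹) i j ∈ O) →
          ∃ H : Set (Matrix (Fin n) (Fin n) (Rp p)),
            H ⊆ galoisGroup δ O u ∧
            (1 : Matrix (Fin n) (Fin n) (Rp p)) ∈ H ∧
            (∀ a ∈ H, ∀ b ∈ H, a * b ∈ H) ∧
            (∀ a ∈ H, ∃ b ∈ H, a * b = 1 ∧ b * a = 1) ∧
            (∀ c ∈ galoisGroup δ O u, {x | ∃ h ∈ H, x = c * h * c⁻¹} = H) ∧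
            (∃ T : Finset (Matrix (Fin n) (Fin n) (Rp p)),
              (↑T : Set (Matrix (Fin n) (Fin n) (Rp p))) ⊆ galoisGroup δ O u ∧
              galoisGroup δ O u = ⋃ t ∈ T, {x | ∃ h ∈ H, x = t * h}) ∧
            ∃ g : Matrix (Fin n) (Fin n) (Kap p), IsUnit g ∧
              ∀ h ∈ H, ∃ d : Fin n → Kap p,
                g⁻¹ * (h.map (toKap p)) * g = Matrix.diagonal d := by
  classical
  refine ⟨{1}, ⟨1, rfl, by simp⟩, ?_⟩
  intro u hu _ O hO _ hα
  have hst := delta_mem_genBy hp2 hδ hO hα (map_delta_eq hu)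
  let Γ := galoisSubgroup δ O u hst
  let val : Γ →* Matrix (Fin n) (Fin n) (Rp p) := (Units.coeHom _).comp Γ.subtype
  have hval : Function.Injective val := Units.val_injective.comp Subtype.val_injective
  have hmem : ∀ c ∈ galoisGroup δ O u, ∃ γ : Γ, val γ = c := by
    intro c hc
    obtain ⟨_, ⟨d, hcd, hdc, _⟩, _⟩ := id hc
    exact ⟨⟨⟨c, d, hcd, hdc⟩, hc⟩, rfl⟩
  have hvmem : ∀ γ : Γ, val γ ∈ galoisGroup δ O u := fun γ => γ.2
  have hinv : ∀ γ : Γ, (val γ)⁻¹ = val γ⁻¹ := fun γ => (Matrix.coe_units_inv γ.1).symm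
  have hfin : ∀ s : Set Γ, s.Finite → Finite (Subgroup.closure s) :=
    finite_closure_galoisSubgroup hδ hu hα hst
  obtain ⟨e⟩ := nonempty_ringEquiv_complex p
  obtain ⟨H', hN, hF, hcomm⟩ := exists_normal_finiteIndex_commute
    (((e.toRingHom.comp (toKap p)).mapMatrix : _ →+* Matrix (Fin n) (Fin n) ℂ).toMonoidHom.comp val)
    hfin
  refine ⟨val '' H', ?_, ⟨1, H'.one_mem, map_one val⟩, ?_, ?_, ?_, ?_, ?_⟩
  · rintro _ ⟨γ, -, rfl⟩
    exact hvmem γ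
  · rintro _ ⟨a, ha, rfl⟩ _ ⟨b, hb, rfl⟩
    exact ⟨a * b, H'.mul_mem ha hb, map_mul val a b⟩
  · rintro _ ⟨a, ha, rfl⟩
    exact ⟨_, ⟨a⁻¹, H'.inv_mem ha, rfl⟩, by rw [← map_mul, mul_inv_cancel, map_one],
      by rw [← map_mul, inv_mul_cancel, map_one]⟩
  · intro c hc
    obtain ⟨γ, rfl⟩ := hmem c hc
    rw [hinv]
    ext x
    constructor
    · rintro ⟨_, ⟨h, hh, rfl⟩, rfl⟩
      exact ⟨γ * h * γ⁻¹, hN.conj_mem h hh γ, by simp only [map_mul]⟩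
    · rintro ⟨h, hh, rfl⟩
      refine ⟨_, ⟨γ⁻¹ * h * γ⁻¹⁻¹, hN.conj_mem h hh γ⁻¹, rfl⟩, ?_⟩
      rw [← map_mul, ← map_mul]
      congr 1
      group
  · have : Finite (Γ ⧸ H') := H'.finite_quotient_of_finiteIndex
    have hT := Set.finite_range fun q : Γ ⧸ H' => val q.out
    refine ⟨hT.toFinset, ?_, ?_⟩
    · rw [hT.coe_toFinset]
      rintro _ ⟨q, rfl⟩
      exact hvmem _
    · ext x
      simp only [Set.mem_iUnion, hT.mem_toFinset, exists_prop, Set.mem_ofPred_eq]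
      constructor
      · intro hx
        obtain ⟨γ, rfl⟩ := hmem x hx
        refine ⟨_, ⟨(γ : Γ ⧸ H'), rfl⟩, _, ⟨(γ : Γ ⧸ H').out⁻¹ * γ, ?_, rfl⟩, ?_⟩
        · exact QuotientGroup.eq.1 (QuotientGroup.out_eq' _)
        · rw [← map_mul, mul_inv_cancel_left]
      · rintro ⟨_, ⟨q, rfl⟩, _, ⟨h, -, rfl⟩, rfl⟩
        rw [← map_mul]
        exact hvmem _
  · have : CharZero (Kap p) :=
      charZero_of_injective_ringHom (f := e.symm.toRingHom) e.symm.injective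
    let ψ : H' → Matrix (Fin n) (Fin n) (Kap p) := fun h => (toKap p).mapMatrix (val h)
    have hψc : ∀ a b, Commute (ψ a) (ψ b) := by
      intro a b
      have hinj : Function.Injective (e.toRingHom.mapMatrix :
          Matrix (Fin n) (Fin n) (Kap p) →+* Matrix (Fin n) (Fin n) ℂ) :=
        Matrix.map_injective e.injective
      apply hinj
      rw [map_mul, map_mul]
      exact hcomm a a.2 b b.2
    have hψo : ∀ h, ∃ k, 0 < k ∧ ψ h ^ k = 1 := by
      intro h
      have := hfin {(h : Γ)} (Set.finite_singleton _)
      obtain ⟨k, hk, hk1⟩ := isOfFinOrder_iff_pow_eq_one.1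
        (isOfFinOrder_of_finite (⟨h, Subgroup.subset_closure rfl⟩ :
          Subgroup.closure ({(h : Γ)} : Set Γ)))
      have h1 : (h : Γ) ^ k = 1 := congrArg Subtype.val hk1
      exact ⟨k, hk, by rw [← map_pow, ← map_pow, h1, map_one, map_one]⟩
    obtain ⟨g, hg, hd⟩ := exists_simultaneous_diagonalization ψ hψc hψo
    refine ⟨g, hg, ?_⟩
    rintro _ ⟨h, hh, rfl⟩
    obtain ⟨d, hd⟩ := hd ⟨h, hh⟩
    refine ⟨d, ?_⟩
    change g⁻¹ * ψ ⟨h, hh⟩ * g = diagonal d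
    rw [mul_assoc, hd, nonsing_inv_mul_cancel_left _ _ ((isUnit_iff_isUnit_det _).1 hg)]
end
end

section
/- Let C be an uncountable algebraically closed field of characteristic zero, let n ≥ 1, and let p ≥ 2 be an integer; for a matrix v over C let v^(p) denote the matrix of entrywise p-th powers. Let X := {v ∈ GL_n(C) : for every integer m ≥ 0, (v^m)^(p) = (v^(p))^m and (v^m)^(p)·(v^{−m})^(p) = 1}, and let T ⊆ GL_n(C) be the set of invertible diagonal matrices. Then T ⊆ X, T is Zariski closed in GL_n(C) and irreducible, and every subset Y ⊆ X that contains the identity matrix and is Zariski closed in GL_n(C) and irreducible is contained in T; i.e., X has exactly one irreducible component passing through the identity, namely T. -/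
noncomputable section

open Matrix

/-- `Y ⊆ GL_n(C)` is Zariski closed in `GL_n(C)`: it is the intersection of
`GL_n(C)` with the common zero set of a family of polynomials in the matrix
entries. -/
def IsZClosed {C : Type*} [Field C] {n : ℕ}
    (Y : Set (Matrix (Fin n) (Fin n) C)) : Prop :=
  ∃ S : Set (MvPolynomial (Fin n × Fin n) C),
    Y = {v | IsUnit v ∧
      ∀ f ∈ S, MvPolynomial.eval (fun ij => v ij.1 ij.2) f = 0}

/-- Irreducibility of a subset of `GL_n(C)` with respect to the Zariski closed
subsets of `GL_n(C)`. -/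
def IsZIrred {C : Type*} [Field C] {n : ℕ}
    (Y : Set (Matrix (Fin n) (Fin n) C)) : Prop :=
  Y.Nonempty ∧
    ∀ Y₁ Y₂ : Set (Matrix (Fin n) (Fin n) C), IsZClosed Y₁ → IsZClosed Y₂ →
      Y ⊆ Y₁ ∪ Y₂ → Y ⊆ Y₁ ∨ Y ⊆ Y₂

/-- The set `X` of Lemma 3.11: all `v ∈ GL_n(C)` with `(v^m)^(p) = (v^(p))^m` and
`(v^m)^(p)·(v^{−m})^(p) = 1` for all `m ≥ 0`. -/
def XSet (C : Type*) [Field C] (n p : ℕ) : Set (Matrix (Fin n) (Fin n) C) :=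
  {v | IsUnit v ∧ ∀ m : ℕ,
    (v ^ m).map (· ^ p) = (v.map (· ^ p)) ^ m ∧
    (v ^ m).map (· ^ p) * ((v⁻¹) ^ m).map (· ^ p) = 1}

/-- The torus `T` of invertible diagonal matrices. -/
def TSet (C : Type*) [Field C] (n : ℕ) : Set (Matrix (Fin n) (Fin n) C) :=
  {v | IsUnit v ∧ ∃ d : Fin n → C, v = Matrix.diagonal d}

section ExponentialPolynomials
open Polynomial

variable {K Γ : Type*} [Field K]

/-- The `K`-linear map on `K[X][Γ]` that applies `T γ` to the coefficient at each `γ`. -/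
def coeffwise (T : Γ → K[X] →ₗ[K] K[X]) :
    MonoidAlgebra K[X] Γ →ₗ[K] MonoidAlgebra K[X] Γ where
  toFun f := .ofCoeff (Finsupp.onFinset f.coeff.support (fun γ => T γ (f.coeff γ)) (by
    intro γ h
    rw [Finsupp.mem_support_iff]
    rintro h0
    simp [h0] at h))
  map_add' f g := by ext; simp
  map_smul' c f := by ext; simp

lemma coeff_coeffwise (T : Γ → K[X] →ₗ[K] K[X]) (f : MonoidAlgebra K[X] Γ) (γ : Γ) :
    (coeffwise T f).coeff γ = T γ (f.coeff γ) := rfl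

lemma coeffwise_single (T : Γ → K[X] →ₗ[K] K[X]) (γ : Γ) (P : K[X]) :
    coeffwise T (.single γ P) = .single γ (T γ P) := by
  classical
  ext δ : 2
  rw [coeff_coeffwise]
  by_cases h : γ = δ
  · subst h; simp
  · simp [h]

variable [CommGroup Γ]

/-- The derivation of `K[X][Γ]` acting on `P(t) γ ^ t` as `d/dt` does when `χ` plays the role of
the logarithm on `Γ`. -/
def expDeriv (χ : Γ →* Multiplicative ℤ) :
    Derivation K (MonoidAlgebra K[X] Γ) (MonoidAlgebra K[X] Γ) :=
  Derivation.mk'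
    (coeffwise fun γ => (derivative : K[X] →ₗ[K] K[X]) + ((χ γ).toAdd : K) • LinearMap.id) <| by
      intro f g
      induction f using MonoidAlgebra.induction_linear with
      | zero => simp
      | add f₁ f₂ h₁ h₂ => rw [add_mul, map_add, h₁, h₂, map_add]; simp only [smul_eq_mul]; ring
      | single γ P =>
        induction g using MonoidAlgebra.induction_linear with
        | zero => simp
        | add f₁ f₂ h₁ h₂ => rw [mul_add, map_add, h₁, h₂, map_add]; simp only [smul_eq_mul]; ring
        | single δ Q =>
          simp only [MonoidAlgebra.single_mul_single, coeffwise_single, smul_eq_mul, mul_comm δ γ,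
            ← MonoidAlgebra.single_add]
          congr 1
          simp [Polynomial.smul_eq_C_mul]
          ring

lemma coeff_expDeriv (χ : Γ →* Multiplicative ℤ) (f : MonoidAlgebra K[X] Γ) (γ : Γ) :
    (expDeriv χ f).coeff γ = derivative (f.coeff γ) + ((χ γ).toAdd : K) • f.coeff γ := rfl

lemma expDeriv_single (χ : Γ →* Multiplicative ℤ) (γ : Γ) (P : K[X]) :
    expDeriv χ (.single γ P) = .single γ (derivative P + ((χ γ).toAdd : K) • P) :=
  coeffwise_single _ _ _

variable (e : Γ →* Kˣ)

/-- The value at `b` of the exponential polynomial `∑ P_γ(t) (e γ) ^ t`. -/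
def expEval (b : ℕ) : MonoidAlgebra K[X] Γ →ₐ[K] K :=
  MonoidAlgebra.liftNCAlgHom (aeval (b : K)) ((powMonoidHom b).comp ((Units.coeHom K).comp e))
    fun _ _ => Commute.all _ _

lemma expEval_single (b : ℕ) (γ : Γ) (P : K[X]) :
    expEval e b (.single γ P) = P.eval (b : K) * (e γ : K) ^ b := by
  simp [expEval, coe_aeval_eq_eval]

/-- Translation of an exponential polynomial by `a`. -/
def expShift (a : ℕ) : MonoidAlgebra K[X] Γ →ₗ[K] MonoidAlgebra K[X] Γ :=
  coeffwise fun γ => ((e γ : K) ^ a) • taylor (a : K)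

lemma expEval_expShift (a b : ℕ) (f : MonoidAlgebra K[X] Γ) :
    expEval e b (expShift e a f) = expEval e (a + b) f := by
  induction f using MonoidAlgebra.induction_linear with
  | zero => simp
  | add f g hf hg => simp only [map_add, hf, hg]
  | single γ P =>
    simp only [expShift, coeffwise_single, expEval_single]
    simp [taylor_eval, add_comm]
    ring

lemma expEval_zero_expDeriv_expShift (χ : Γ →* Multiplicative ℤ) (a : ℕ)
    (f : MonoidAlgebra K[X] Γ) :
    expEval e 0 (expDeriv χ (expShift e a f)) = expEval e a (expDeriv χ f) := by
  induction f using MonoidAlgebra.induction_linear with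
  | zero => simp
  | add f g hf hg => simp only [map_add, hf, hg]
  | single γ P =>
    simp only [expShift, coeffwise_single, expEval_single, expDeriv_single]
    simp [taylor_apply, derivative_comp]
    ring

lemma geom_mul_eval_mem_maxGenEigenspace (c : K) (P : K[X]) :
    (fun b : ℕ => P.eval (b : K) * c ^ b) ∈
      Module.End.maxGenEigenspace (LinearMap.funLeft K K (Nat.succ)) c := by
  rw [Module.End.mem_maxGenEigenspace]
  have key : ∀ (N : ℕ) (g : K → K),
      ((LinearMap.funLeft K K Nat.succ - c • (1 : Module.End K (ℕ → K))) ^ N)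
        (fun b : ℕ => g b * c ^ b) = fun b : ℕ => ((fwdDiff 1)^[N] g) b * c ^ (b + N) := by
    intro N
    induction N with
    | zero => intro g; simp
    | succ N ih =>
      intro g
      have hstep : (LinearMap.funLeft K K Nat.succ - c • (1 : Module.End K (ℕ → K)))
          (fun b : ℕ => g b * c ^ b) = c • fun b : ℕ => fwdDiff 1 g b * c ^ b := by
        funext b
        simp [LinearMap.funLeft_apply, fwdDiff]
        ring
      rw [pow_succ, Module.End.mul_apply, hstep, map_smul, ih, Function.iterate_succ_apply]
      funext b
      simp only [Pi.smul_apply, smul_eq_mul]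
      ring
  refine ⟨P.natDegree + 1, ?_⟩
  rw [key _ P.eval, P.fwdDiff_iter_degree_add_one_eq_zero]
  funext b
  simp

/-- An exponential polynomial with distinct nonzero bases that vanishes on `ℕ` is zero. -/
lemma eq_zero_of_expEval_eq_zero [CharZero K] (he : Function.Injective e)
    (f : MonoidAlgebra K[X] Γ) (hf : ∀ b, expEval e b f = 0) : f = 0 := by
  classical
  have hind := (Module.End.independent_maxGenEigenspace (LinearMap.funLeft K K Nat.succ)).comp
    (f := fun γ => (e γ : K)) (Units.val_injective.comp he)
  rw [iSupIndep_iff_finsetSum_eq_zero_imp_eq_zero] at hind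
  ext γ : 2
  by_cases hγ : γ ∈ f.coeff.support
  · have h := hind f.coeff.support (fun γ b => (f.coeff γ).eval (b : K) * (e γ : K) ^ b)
      (fun i _ => geom_mul_eval_mem_maxGenEigenspace _ _) (by
        funext b
        have := hf b
        rw [← MonoidAlgebra.sum_coeff_single f, Finsupp.sum, map_sum] at this
        simpa [expEval_single] using this) γ hγ
    refine Polynomial.eq_zero_of_infinite_isRoot _
      ((Set.infinite_range_of_injective (Nat.cast_injective (R := K))).mono ?_)
    rintro _ ⟨b, rfl⟩
    simpa using congrFun h b
  · simpa using hγ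

/-- A common eigenvector of all the derivations `expDeriv χ` that vanishes at `0` is zero. -/
lemma eq_zero_of_expDeriv_eq_smul [CharZero K]
    (hsep : ∀ γ δ : Γ, (∀ χ : Γ →* Multiplicative ℤ, χ γ = χ δ) → γ = δ)
    (f : MonoidAlgebra K[X] Γ) (h0 : expEval e 0 f = 0)
    (hf : ∀ χ : Γ →* Multiplicative ℤ, ∃ m : K, expDeriv χ f = m • f) : f = 0 := by
  classical
  have key : ∀ (χ : Γ →* Multiplicative ℤ) (m : K), expDeriv χ f = m • f →
      ∀ γ, f.coeff γ ≠ 0 → derivative (f.coeff γ) = 0 ∧ ((χ γ).toAdd : K) = m := by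
    intro χ m h γ hγ
    have h1 : derivative (f.coeff γ) + ((χ γ).toAdd : K) • f.coeff γ = m • f.coeff γ := by
      rw [← coeff_expDeriv, h]; rfl
    have h2 : derivative (f.coeff γ) = (m - ((χ γ).toAdd : K)) • f.coeff γ := by
      rw [sub_smul, ← h1]; simp
    have h3 : ((χ γ).toAdd : K) = m := by
      by_contra hne
      have hne' : m - ((χ γ).toAdd : K) ≠ 0 := sub_ne_zero.mpr (Ne.symm hne)
      have := degree_derivative_lt hγ
      rw [h2, Polynomial.smul_eq_C_mul, degree_C_mul hne'] at this
      exact lt_irrefl _ this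
    refine ⟨?_, h3⟩
    rw [h2, h3]; simp
  by_contra hne
  obtain ⟨γ, hγ⟩ : ∃ γ, f.coeff γ ≠ 0 := by
    by_contra! h
    exact hne (by ext γ : 2; simpa using h γ)
  have huniq : ∀ δ, f.coeff δ ≠ 0 → γ = δ := fun δ hδ => hsep γ δ fun χ => by
    obtain ⟨m, hm⟩ := hf χ
    have := (key χ m hm γ hγ).2.trans (key χ m hm δ hδ).2.symm
    exact Multiplicative.toAdd.injective (by exact_mod_cast this)
  have hfs : f = .single γ (f.coeff γ) := by
    ext δ : 2
    by_cases h : γ = δ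
    · subst h; simp
    · have : f.coeff δ = 0 := by
        by_contra h'; exact h (huniq δ h')
      simp [h, this]
  obtain ⟨m, hm⟩ := hf 1
  have hd := (key 1 m hm γ hγ).1
  have hC := derivative_eq_zero.mp hd
  rw [natDegree_eq_zero] at hC
  obtain ⟨c, hc⟩ := hC
  rw [hfs, expEval_single, ← hc] at h0
  apply hγ
  rw [← hc]
  simpa using h0

end ExponentialPolynomials

section MatrixPowers
open Polynomial

variable {K : Type*} [Field K]

lemma exists_eval_eq_choose [CharZero K] (i : ℕ) :
    ∃ P : K[X], ∀ b : ℕ, P.eval (b : K) = (b.choose i : K) := by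
  refine ⟨C ((i.factorial : K)⁻¹) * descPochhammer K i, fun b => ?_⟩
  have h : (i.factorial : K) ≠ 0 := by exact_mod_cast i.factorial_ne_zero
  rw [eval_mul, eval_C, descPochhammer_eval_eq_descFactorial,
    Nat.descFactorial_eq_factorial_mul_choose]
  push_cast
  field_simp

/-- The orbit of a vector under an injective endomorphism of `K ^ n` is given by exponential
polynomials. -/
lemma exists_expEval_eq_pow_apply [IsAlgClosed K] [CharZero K] {n : ℕ}
    (v : Module.End K (Fin n → K)) (hv : Function.Injective v) (x : Fin n → K) :
    ∃ F : Fin n → MonoidAlgebra K[X] Kˣ,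
      ∀ (b : ℕ) (i : Fin n), (v ^ b) x i = expEval (MonoidHom.id Kˣ) b (F i) := by
  have hx : x ∈ ⨆ μ, v.maxGenEigenspace μ := by
    rw [Module.End.iSup_maxGenEigenspace_eq_top]; trivial
  induction hx using Submodule.iSup_induction' with
  | zero => exact ⟨0, by simp⟩
  | add x y _ _ hx hy =>
    obtain ⟨F, hF⟩ := hx
    obtain ⟨G, hG⟩ := hy
    exact ⟨F + G, fun b i => by simp [hF, hG]⟩
  | mem μ x hx =>
    rw [Module.End.mem_maxGenEigenspace] at hx
    obtain ⟨N, hN⟩ := hx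
    by_cases hμ : μ = 0
    · subst hμ
      have hinj : Function.Injective (v ^ N) := by
        rw [Module.End.coe_pow]; exact hv.iterate N
      have : x = 0 := hinj (by simpa using hN)
      exact ⟨0, by simp [this]⟩
    choose P hP using exists_eval_eq_choose (K := K)
    set u : Module.End K (Fin n → K) := v - μ • 1 with hu
    have huz : ∀ i, N ≤ i → (u ^ i) x = 0 := by
      intro i hi
      obtain ⟨j, rfl⟩ := Nat.exists_eq_add_of_le' hi
      rw [pow_add, Module.End.mul_apply, hN, map_zero]
    refine ⟨fun j => .single (Units.mk0 μ hμ)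
      (∑ i ∈ Finset.range N, C ((u ^ i) x j * (μ ^ i)⁻¹) * P i), fun b j => ?_⟩
    rw [expEval_single]
    simp only [eval_finsetSum, eval_mul, eval_C, hP, MonoidHom.id_apply, Units.val_mk0]
    have hvu : v = u + μ • 1 := by simp [hu]
    have hcomm : Commute u (μ • (1 : Module.End K (Fin n → K))) :=
      (Commute.one_right u).smul_right μ
    have h1 : (v ^ b) x j = ∑ i ∈ Finset.range (b + 1),
        (u ^ i) x j * (μ ^ i)⁻¹ * (b.choose i : K) * μ ^ b := by
      rw [hvu, hcomm.add_pow, LinearMap.sum_apply, Finset.sum_apply]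
      refine Finset.sum_congr rfl fun i hi => ?_
      have hib : i ≤ b := Nat.lt_succ_iff.mp (Finset.mem_range.mp hi)
      rw [_root_.smul_pow, one_pow, ← nsmul_eq_mul']
      obtain ⟨c, rfl⟩ := Nat.exists_eq_add_of_le hib
      simp [pow_add]
      field_simp
    have h2 : ∀ M, b + 1 ≤ M → ∑ i ∈ Finset.range (b + 1),
        (u ^ i) x j * (μ ^ i)⁻¹ * (b.choose i : K) * μ ^ b = ∑ i ∈ Finset.range M,
        (u ^ i) x j * (μ ^ i)⁻¹ * (b.choose i : K) * μ ^ b := by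
      intro M hM
      refine Finset.sum_subset (Finset.range_mono hM) fun i _ hi => ?_
      rw [Finset.mem_range, not_lt] at hi
      simp [Nat.choose_eq_zero_of_lt hi]
    have h3 : ∀ M, N ≤ M → ∑ i ∈ Finset.range N,
        (u ^ i) x j * (μ ^ i)⁻¹ * (b.choose i : K) * μ ^ b = ∑ i ∈ Finset.range M,
        (u ^ i) x j * (μ ^ i)⁻¹ * (b.choose i : K) * μ ^ b := by
      intro M hM
      refine Finset.sum_subset (Finset.range_mono hM) fun i _ hi => ?_
      rw [Finset.mem_range, not_lt] at hi
      simp [huz i hi]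
    rw [h1, h2 (max (b + 1) N) (le_max_left _ _), Finset.sum_mul, ← h3 _ (le_max_right _ _)]

/-- The entries of the powers of an invertible matrix are exponential polynomials. -/
lemma exists_expEval_eq_pow [IsAlgClosed K] [CharZero K] {n : ℕ}
    (v : Matrix (Fin n) (Fin n) K) (hv : IsUnit v) :
    ∃ F : Matrix (Fin n) (Fin n) (MonoidAlgebra K[X] Kˣ),
      ∀ (b : ℕ) (i j : Fin n), (v ^ b) i j = expEval (MonoidHom.id Kˣ) b (F i j) := by
  have hinj : Function.Injective (Matrix.toLin' v) := by
    exact Matrix.mulVec_injective_of_isUnit hv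
  choose F hF using fun j => exists_expEval_eq_pow_apply _ hinj (Pi.single j (1 : K))
  refine ⟨fun i j => F j i, fun b i j => ?_⟩
  rw [← hF, ← Matrix.toLin'_pow, Matrix.toLin'_apply, Matrix.mulVec_single_one, Matrix.col_apply]

/-- Some common power of the elements of a finite subset of an abelian group lies in a finitely
generated free subgroup. -/
lemma exists_injective_hom_pow_mem_range {G : Type*} [CommGroup G] (s : Finset G) :
    ∃ (k r : ℕ) (e : Multiplicative (Fin r →₀ ℤ) →* G), 0 < k ∧ Function.Injective e ∧
      ∀ x ∈ s, ∃ γ, e γ = x ^ k := by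
  have hfg : AddGroup.FG (Additive (Subgroup.closure (s : Set G))) := by
    have : Group.FG (Subgroup.closure (s : Set G)) := Group.closure_finset_fg s
    infer_instance
  obtain ⟨r, ι, _, p, hp, m, ⟨f⟩⟩ :=
    AddCommGroup.equiv_free_prod_directSum_zmod (Additive (Subgroup.closure (s : Set G)))
  have hne : ∀ i, NeZero (p i ^ m i) := fun i => ⟨pow_ne_zero _ (hp i).ne_zero⟩
  have hfin : Finite (DirectSum ι fun i => ZMod (p i ^ m i)) :=
    Finite.of_equiv _ DFinsupp.equivFunOnFintype.symm
  let ι₀ : Multiplicative (Fin r →₀ ℤ) →* Subgroup.closure (s : Set G) :=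
    AddMonoidHom.toMultiplicativeLeft
      (f.symm.toAddMonoidHom.comp (AddMonoidHom.inl _ (DirectSum ι fun i => ZMod (p i ^ m i))))
  refine ⟨Nat.card (DirectSum ι fun i => ZMod (p i ^ m i)), r,
    (Subgroup.subtype _).comp ι₀, Nat.card_pos, ?_, ?_⟩
  · refine Subtype.val_injective.comp fun a b hab => ?_
    have h := f.symm.injective (show f.symm (a.toAdd, 0) = f.symm (b.toAdd, 0) from hab)
    exact congrArg Prod.fst h
  · intro x hx
    let y : Additive (Subgroup.closure (s : Set G)) := .ofMul ⟨x, Subgroup.subset_closure hx⟩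
    refine ⟨.ofAdd (Nat.card (DirectSum ι fun i => ZMod (p i ^ m i)) • (f y).1), ?_⟩
    have h : f.symm (Nat.card (DirectSum ι fun i => ZMod (p i ^ m i)) • (f y).1, 0) =
        Nat.card (DirectSum ι fun i => ZMod (p i ^ m i)) • y := by
      rw [AddEquiv.symm_apply_eq, map_nsmul]
      exact Prod.ext rfl (card_nsmul_eq_zero' (x := (f y).2)).symm
    exact congrArg (fun z : Additive (Subgroup.closure (s : Set G)) => (z.toMul : G)) h

variable {n : ℕ}

/-- Let the powers of `v` be given by exponential polynomials with frequencies in a torsion-free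
group. If taking entrywise `p`-th powers commutes with taking powers of `v`, then `v` is
diagonal. -/
lemma apply_eq_zero_of_map_pow_eq [CharZero K] {Γ : Type*} [CommGroup Γ] [UniqueProds Γ]
    (e : Γ →* Kˣ) (he : Function.Injective e)
    (hsep : ∀ γ δ : Γ, (∀ χ : Γ →* Multiplicative ℤ, χ γ = χ δ) → γ = δ)
    {p : ℕ} (hp : 2 ≤ p) (v : Matrix (Fin n) (Fin n) K)
    (hv : ∀ m : ℕ, (v ^ m).map (· ^ p) = (v.map (· ^ p)) ^ m)
    (F : Matrix (Fin n) (Fin n) (MonoidAlgebra K[X] Γ))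
    (hF : ∀ (b : ℕ) (i j : Fin n), expEval e b (F i j) = (v ^ b) i j)
    {i j : Fin n} (hij : i ≠ j) : v i j = 0 := by
  have hinj : ∀ f g : MonoidAlgebra K[X] Γ, (∀ b, expEval e b f = expEval e b g) → f = g :=
    fun f g h => sub_eq_zero.mp <| eq_zero_of_expEval_eq_zero e he _ fun b => by
      rw [map_sub, h, sub_self]
  suffices h : F i j = 0 by
    have := hF 1 i j
    rw [h, map_zero, pow_one] at this
    exact this.symm
  by_contra hne
  refine hne (eq_zero_of_expDeriv_eq_smul e hsep _ ?_ fun χ => ?_)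
  · rw [hF, pow_zero, Matrix.one_apply_ne hij]
  set M : Matrix (Fin n) (Fin n) K := fun k l => expEval e 0 (expDeriv χ (F k l)) with hM
  have hderiv : ∀ k l, expDeriv χ (F k l) = ∑ t, M t l • F k t := by
    intro k l
    refine hinj _ _ fun a => ?_
    have hshift : expShift e a (F k l) = ∑ t, (v ^ a) k t • F t l := by
      refine hinj _ _ fun b => ?_
      rw [expEval_expShift, hF, pow_add, Matrix.mul_apply]
      simp [hF]
    rw [← expEval_zero_expDeriv_expShift, hshift]
    simp [hF, hM, mul_comm]
  have hadd : ∀ a b k l, (∑ t, (v ^ a) k t * (v ^ b) t l) ^ p =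
      ∑ t, ((v ^ a) k t) ^ p * ((v ^ b) t l) ^ p := by
    intro a b k l
    have h := congrFun (congrFun (hv (a + b)) k) l
    rw [pow_add, pow_add, ← hv, ← hv] at h
    simpa [Matrix.mul_apply] using h
  have htangent : ∀ a k l, ((v ^ a) k l) ^ (p - 1) * ∑ t, M t l * (v ^ a) k t =
      M l l * ((v ^ a) k l) ^ p := by
    intro a k l
    have hR : (∑ t, (v ^ a) k t • F t l) ^ p = ∑ t, ((v ^ a) k t) ^ p • F t l ^ p := by
      refine hinj _ _ fun b => ?_
      simpa [hF] using hadd a b k l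
    have hD := congrArg (fun f => expEval e 0 (expDeriv χ f)) hR
    have hp1 : p - 1 ≠ 0 := by omega
    have hp0 : (p : K) ≠ 0 := by exact_mod_cast (by omega : p ≠ 0)
    simp only [Derivation.leibniz_pow, Derivation.map_smul, map_sum, map_smul, map_pow, map_natCast,
      map_mul, hF, Matrix.one_apply, smul_eq_mul, nsmul_eq_mul, pow_zero, ite_pow, one_pow,
      zero_pow hp1, mul_ite, ite_mul, mul_one, one_mul, mul_zero, zero_mul, Finset.sum_ite_eq',
      Finset.mem_univ, if_true] at hD
    refine mul_left_cancel₀ hp0 ?_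
    simp only [hM, mul_comm (expEval e 0 _)]
    rw [hD]
    ring
  have hprod : F i j ^ (p - 1) * (∑ t, M t j • F i t - M j j • F i j) = 0 := by
    refine hinj _ _ fun a => ?_
    have := htangent a i j
    have hpp : (v ^ a) i j ^ p = (v ^ a) i j ^ (p - 1) * (v ^ a) i j := by
      rw [← pow_succ]; congr 1; omega
    simp only [map_mul, map_pow, map_sub, map_sum, map_smul, hF, smul_eq_mul, map_zero]
    rw [mul_sub, this, hpp]
    ring
  refine ⟨M j j, ?_⟩
  rw [hderiv]
  exact sub_eq_zero.mp ((mul_eq_zero.mp hprod).resolve_left (pow_ne_zero _ hne))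

/-- If taking entrywise `p`-th powers commutes with taking powers of the invertible matrix `v`,
then some power of `v` is diagonal. -/
lemma exists_pow_isDiag_of_map_pow_eq [IsAlgClosed K] [CharZero K] {p : ℕ} (hp : 2 ≤ p)
    (v : Matrix (Fin n) (Fin n) K) (hu : IsUnit v)
    (hv : ∀ m : ℕ, (v ^ m).map (· ^ p) = (v.map (· ^ p)) ^ m) :
    ∃ k : ℕ, 0 < k ∧ (v ^ k).IsDiag := by
  classical
  obtain ⟨F, hF⟩ := exists_expEval_eq_pow v hu
  obtain ⟨k, r, e, hk, he, hs⟩ := exists_injective_hom_pow_mem_range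
    (Finset.univ.biUnion fun ij : Fin n × Fin n => (F ij.1 ij.2).coeff.support)
  refine ⟨k, hk, fun i j hij => ?_⟩
  choose! γ hγ using hs
  refine apply_eq_zero_of_map_pow_eq e he ?_ hp (v ^ k) (fun m => ?_)
    (fun i j => ∑ x ∈ (F i j).coeff.support,
      .single (γ x) (((F i j).coeff x).comp (C (k : K) * X))) (fun b i j => ?_) hij
  · intro x y h
    refine Multiplicative.toAdd.injective (Finsupp.ext fun l => ?_)
    exact congrArg Multiplicative.toAdd
      (h (AddMonoidHom.toMultiplicative (Finsupp.applyAddHom l)))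
  · rw [← pow_mul, hv, hv, pow_mul]
  · rw [← pow_mul, hF, map_sum]
    conv_rhs => rw [← MonoidAlgebra.sum_coeff_single (F i j), Finsupp.sum, map_sum]
    refine Finset.sum_congr rfl fun x hx => ?_
    rw [expEval_single, expEval_single,
      hγ x (Finset.mem_biUnion.mpr ⟨(i, j), Finset.mem_univ _, hx⟩)]
    simp [pow_mul]

end MatrixPowers

section RootsOfDiagonal
open scoped Kronecker

variable {A : Type*} [CommRing A] {n : ℕ}

/-- The matrix of `x ↦ ∑ a < k, v ^ a * x * v ^ (k - 1 - a)`. -/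
def powDiffMatrix (v : Matrix (Fin n) (Fin n) A) (k : ℕ) :
    Matrix (Fin n × Fin n) (Fin n × Fin n) A :=
  ∑ a ∈ Finset.range k, (v ^ (k - 1 - a))ᵀ ⊗ₖ (v ^ a)

lemma powDiffMatrix_mulVec (v x : Matrix (Fin n) (Fin n) A) (k : ℕ) :
    powDiffMatrix v k *ᵥ vec (v * x - x * v) = vec (v ^ k * x - x * v ^ k) := by
  rw [powDiffMatrix, Matrix.sum_mulVec]
  simp only [kronecker_mulVec_vec, transpose_transpose]
  rw [← Matrix.vec_sum]
  congr 1
  have h := Finset.sum_range_sub (fun a => v ^ a * x * v ^ (k - a)) k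
  simp only [Nat.sub_self, pow_zero, Nat.sub_zero, mul_one, one_mul] at h
  rw [← h]
  refine Finset.sum_congr rfl fun a ha => ?_
  have hak : k - a = k - 1 - a + 1 := by have := Finset.mem_range.mp ha; omega
  have hak' : k - (a + 1) = k - 1 - a := by omega
  rw [hak, hak', pow_succ v a, pow_succ' v (k - 1 - a)]
  noncomm_ring

/-- A matrix with a diagonal `k`-th power is diagonal if no ratio of two of its eigenvalues is a
nontrivial `k`-th root of unity. -/
lemma isDiag_of_isDiag_pow [IsDomain A] {v : Matrix (Fin n) (Fin n) A} {k : ℕ}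
    (hdet : (powDiffMatrix v k).det ≠ 0) (hd : (v ^ k).IsDiag) : v.IsDiag := by
  intro i j hij
  have hz : v * diagonal (Pi.single j 1) - diagonal (Pi.single j 1) * v = 0 := by
    rw [← vec_eq_zero_iff]
    apply Matrix.eq_zero_of_mulVec_eq_zero hdet
    rw [powDiffMatrix_mulVec, ← hd.diagonal_diag, diagonal_mul_diagonal, diagonal_mul_diagonal]
    simp [mul_comm]
  simpa [hij] using congrFun (congrFun hz i) j

lemma det_powDiffMatrix_one (k : ℕ) :
    (powDiffMatrix (1 : Matrix (Fin n) (Fin n) A) k).det = (k : A) ^ (n * n) := by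
  have : powDiffMatrix (1 : Matrix (Fin n) (Fin n) A) k = (k : A) • 1 := by
    simp [powDiffMatrix, Nat.cast_smul_eq_nsmul]
  rw [this, det_smul]
  simp

lemma map_powDiffMatrix {B : Type*} [CommRing B] (f : A →+* B) (v : Matrix (Fin n) (Fin n) A)
    (k : ℕ) : f.mapMatrix (powDiffMatrix v k) = powDiffMatrix (f.mapMatrix v) k := by
  simp only [powDiffMatrix, map_sum, ← map_pow]
  refine Finset.sum_congr rfl fun a _ => ?_
  ext
  simp [-transpose_pow]

end RootsOfDiagonal

section CoordinateRing

variable {C : Type*} [Field C] {n : ℕ}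

/-- The ring of polynomial functions on a set of matrices. -/
abbrev coordRing (Y : Set (Matrix (Fin n) (Fin n) C)) : Subring (Y → C) :=
  (RingHom.pi fun y : Y =>
    (MvPolynomial.eval fun ij : Fin n × Fin n => y.1 ij.1 ij.2)).range

/-- Evaluation of polynomial functions at a point. -/
def evalAt {Y : Set (Matrix (Fin n) (Fin n) C)} (y : Y) : coordRing Y →+* C :=
  (Pi.evalRingHom _ y).comp (coordRing Y).subtype

lemma coordRing_ext {Y : Set (Matrix (Fin n) (Fin n) C)} {a b : coordRing Y}
    (h : ∀ y, evalAt y a = evalAt y b) : a = b :=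
  Subtype.ext (funext h)

/-- The tautological matrix of coordinate functions. -/
def genericMatrix (Y : Set (Matrix (Fin n) (Fin n) C)) :
    Matrix (Fin n) (Fin n) (coordRing Y) :=
  Matrix.of fun i j => ⟨_, MvPolynomial.X (i, j), rfl⟩

lemma evalAt_genericMatrix {Y : Set (Matrix (Fin n) (Fin n) C)} (y : Y) :
    (evalAt y).mapMatrix (genericMatrix Y) = y.1 := by
  ext i j
  exact MvPolynomial.eval_X (i, j)

lemma isZClosed_zeroLocus (f : MvPolynomial (Fin n × Fin n) C) :
    IsZClosed {v : Matrix (Fin n) (Fin n) C |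
      IsUnit v ∧ MvPolynomial.eval (fun ij => v ij.1 ij.2) f = 0} :=
  ⟨{f}, by simp⟩

lemma IsZIrred.isDomain_coordRing {Y : Set (Matrix (Fin n) (Fin n) C)} (hY : IsZIrred Y)
    (hu : ∀ y ∈ Y, IsUnit y) : IsDomain (coordRing Y) := by
  obtain ⟨y₀, hy₀⟩ := hY.1
  have : Nontrivial (coordRing Y) := (evalAt ⟨y₀, hy₀⟩).domain_nontrivial
  have : NoZeroDivisors (coordRing Y) := by
    refine ⟨?_⟩
    rintro ⟨_, f, rfl⟩ ⟨_, g, rfl⟩ hfg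
    have hfg' : ∀ y : Y, MvPolynomial.eval (fun ij => y.1 ij.1 ij.2) f *
        MvPolynomial.eval (fun ij => y.1 ij.1 ij.2) g = 0 :=
      fun y => congrArg (evalAt y) hfg
    refine (hY.2 _ _ (isZClosed_zeroLocus f) (isZClosed_zeroLocus g) fun y hy => ?_).imp
      (fun h => coordRing_ext fun y => (h y.2).2) (fun h => coordRing_ext fun y => (h y.2).2)
    exact (mul_eq_zero.mp (hfg' ⟨y, hy⟩)).imp (fun h => ⟨hu y hy, h⟩) (fun h => ⟨hu y hy, h⟩)
  exact NoZeroDivisors.to_isDomain _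

/-- An irreducible subset of `XSet C n p` through the identity consists of diagonal matrices. -/
lemma isDiag_of_isZIrred_of_one_mem [CharZero C] {p : ℕ} (hp : 2 ≤ p)
    {Y : Set (Matrix (Fin n) (Fin n) C)} (hX : Y ⊆ XSet C n p) (h1 : 1 ∈ Y) (hY : IsZIrred Y)
    {y : Matrix (Fin n) (Fin n) C} (hy : y ∈ Y) : y.IsDiag := by
  have hdom := hY.isDomain_coordRing fun y hy => (hX hy).1
  let L := AlgebraicClosure (FractionRing (coordRing Y))
  let ψ : coordRing Y →+* L :=
    (algebraMap (FractionRing (coordRing Y)) L).comp (algebraMap _ _)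
  have hψ : Function.Injective ψ := (algebraMap (FractionRing (coordRing Y)) L).injective.comp
    (IsFractionRing.injective (coordRing Y) (FractionRing (coordRing Y)))
  have hchar : CharZero (coordRing Y) := charZero_of_inj_zero fun m hm => by
    have := congrArg (evalAt ⟨1, h1⟩) hm
    simpa using this
  have hcharL : CharZero L := charZero_of_injective_ringHom hψ
  have hgen : ∀ m : ℕ, (genericMatrix Y ^ m).map (· ^ p) = ((genericMatrix Y).map (· ^ p)) ^ m := by
    intro m
    refine Matrix.ext fun i j => coordRing_ext fun z => ?_
    have hz := congrFun (congrFun ((hX z.2).2 m).1 i) j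
    rw [← evalAt_genericMatrix z, ← map_pow] at hz
    have hmap : ((evalAt z).mapMatrix (genericMatrix Y)).map (· ^ p) =
        (evalAt z).mapMatrix ((genericMatrix Y).map (· ^ p)) := by
      ext; simp
    rw [hmap, ← map_pow] at hz
    simpa using hz
  obtain ⟨k, hk, hdiag⟩ := exists_pow_isDiag_of_map_pow_eq hp (ψ.mapMatrix (genericMatrix Y))
    (by
      rw [Matrix.isUnit_iff_isUnit_det, isUnit_iff_ne_zero, ← RingHom.map_det]
      refine (map_ne_zero_iff ψ hψ).mpr fun h0 => ?_
      have := congrArg (evalAt ⟨1, h1⟩) h0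
      rw [RingHom.map_det, evalAt_genericMatrix] at this
      simp at this)
    (fun m => by
      have hmap : ∀ w : Matrix (Fin n) (Fin n) (coordRing Y),
          (ψ.mapMatrix w).map (· ^ p) = ψ.mapMatrix (w.map (· ^ p)) := by
        intro w; ext; simp
      rw [← map_pow, hmap, hmap, ← map_pow, hgen])
  have hdiag' : (genericMatrix Y ^ k).IsDiag := by
    intro i j hij
    have := hdiag hij
    rw [← map_pow] at this
    exact hψ (by simpa using this)
  have hgd : (genericMatrix Y).IsDiag := by
    refine isDiag_of_isDiag_pow (fun h0 => ?_) hdiag'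
    have := congrArg (evalAt ⟨1, h1⟩) h0
    rw [RingHom.map_det, map_powDiffMatrix, evalAt_genericMatrix, det_powDiffMatrix_one,
      map_zero] at this
    exact pow_ne_zero _ (Nat.cast_ne_zero.mpr hk.ne') this
  intro i j hij
  have h := congrFun (congrFun (evalAt_genericMatrix (⟨y, hy⟩ : Y)) i) j
  rw [RingHom.mapMatrix_apply, Matrix.map_apply, hgd hij, map_zero] at h
  exact h.symm

end CoordinateRing

section Torus

variable {C : Type*} [Field C] {n : ℕ}

lemma isUnit_diagonal_iff {d : Fin n → C} : IsUnit (diagonal d) ↔ ∀ i, d i ≠ 0 := by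
  rw [Matrix.isUnit_iff_isUnit_det, det_diagonal, isUnit_iff_ne_zero, Finset.prod_ne_zero_iff]
  simp

lemma TSet_subset_XSet {p : ℕ} (hp : p ≠ 0) : TSet C n ⊆ XSet C n p := by
  rintro _ ⟨hu, d, rfl⟩
  refine ⟨hu, fun m => ?_⟩
  have hd := isUnit_diagonal_iff.mp hu
  have hinv : (diagonal d)⁻¹ = diagonal fun i => (d i)⁻¹ := by
    refine inv_eq_right_inv ?_
    rw [diagonal_mul_diagonal, ← diagonal_one]
    congr 1
    funext i
    exact mul_inv_cancel₀ (hd i)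
  rw [hinv]
  simp only [diagonal_pow, diagonal_map (f := fun x : C => x ^ p) (zero_pow hp),
    diagonal_mul_diagonal]
  refine ⟨?_, ?_⟩
  · congr 1
    funext i
    simp [← pow_mul, mul_comm]
  · rw [← diagonal_one]
    congr 1
    funext i
    simp [hd i]

lemma isZClosed_TSet : IsZClosed (TSet C n) := by
  refine ⟨{f | ∃ i j, i ≠ j ∧ f = MvPolynomial.X (i, j)}, ?_⟩
  ext v
  refine and_congr_right fun _ => ⟨?_, fun h => ⟨v.diag, ?_⟩⟩
  · rintro ⟨d, rfl⟩ _ ⟨i, j, hij, rfl⟩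
    simp [hij]
  · refine (Matrix.IsDiag.diagonal_diag fun i j hij => ?_).symm
    simpa using h _ ⟨i, j, hij, rfl⟩

lemma isZIrred_TSet [Infinite C] : IsZIrred (TSet C n) := by
  classical
  refine ⟨⟨1, isUnit_one, 1, diagonal_one.symm⟩, ?_⟩
  rintro _ _ ⟨S₁, rfl⟩ ⟨S₂, rfl⟩ hsub
  by_contra! hcon
  obtain ⟨⟨_, ⟨hu₁, d₁, rfl⟩, h₁⟩, ⟨_, ⟨hu₂, d₂, rfl⟩, h₂⟩⟩ :=
    And.imp Set.not_subset.mp Set.not_subset.mp hcon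
  simp only [Set.mem_ofPred_eq, not_and, not_forall] at h₁ h₂
  obtain ⟨f₁, hf₁, hne₁⟩ := h₁ hu₁
  obtain ⟨f₂, hf₂, hne₂⟩ := h₂ hu₂
  let r : MvPolynomial (Fin n × Fin n) C →ₐ[C] MvPolynomial (Fin n) C :=
    MvPolynomial.aeval fun ij => if ij.1 = ij.2 then MvPolynomial.X ij.1 else 0
  have hr : ∀ (d : Fin n → C) f, MvPolynomial.eval d (r f) =
      MvPolynomial.eval (fun ij : Fin n × Fin n => diagonal d ij.1 ij.2) f := by
    intro d f
    induction f using MvPolynomial.induction_on with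
    | C a => simp [r]
    | add f g hf hg => simp only [map_add, hf, hg]
    | mul_X f ij hf =>
      simp only [map_mul, hf, MvPolynomial.eval_X]
      congr 1
      by_cases h : ij.1 = ij.2 <;> simp [r, h]
  have hprod : r f₁ * r f₂ * ∏ i, MvPolynomial.X i ≠ 0 := by
    refine mul_ne_zero (mul_ne_zero ?_ ?_)
      (Finset.prod_ne_zero_iff.mpr fun i _ => MvPolynomial.X_ne_zero i)
    · intro h; rw [← hr, h, map_zero] at hne₁; exact hne₁ rfl
    · intro h; rw [← hr, h, map_zero] at hne₂; exact hne₂ rfl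
  obtain ⟨d, hd⟩ : ∃ d, MvPolynomial.eval d (r f₁ * r f₂ * ∏ i, MvPolynomial.X i) ≠ 0 := by
    by_contra! h
    exact hprod (MvPolynomial.funext fun d => by rw [h, map_zero])
  simp only [map_mul, map_prod, MvPolynomial.eval_X, hr] at hd
  have hd0 : ∀ i, d i ≠ 0 := by
    simpa [Finset.prod_ne_zero_iff] using right_ne_zero_of_mul hd
  have hd12 := left_ne_zero_of_mul hd
  rcases hsub ⟨isUnit_diagonal_iff.mpr hd0, d, rfl⟩ with h | h
  · exact left_ne_zero_of_mul hd12 (h.2 _ hf₁)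
  · exact right_ne_zero_of_mul hd12 (h.2 _ hf₂)

end Torus

/-- over an uncountable algebraically closed field `C` of
characteristic zero, `X` has exactly one irreducible component passing through the
identity, namely `T`. -/
theorem statement19 (C : Type) [Field C] [IsAlgClosed C] [CharZero C] [Uncountable C]
    (n : ℕ) (hn : 1 ≤ n) (p : ℕ) (hp : 2 ≤ p) :
    TSet C n ⊆ XSet C n p ∧ IsZClosed (TSet C n) ∧ IsZIrred (TSet C n) ∧
      ∀ Y : Set (Matrix (Fin n) (Fin n) C), Y ⊆ XSet C n p →
        (1 : Matrix (Fin n) (Fin n) C) ∈ Y → IsZClosed Y → IsZIrred Y →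
        Y ⊆ TSet C n := by
  exact ⟨TSet_subset_XSet (by omega), isZClosed_TSet, isZIrred_TSet, fun Y hX h1 _ hirr y hy =>
    ⟨(hX hy).1, y.diag, (isDiag_of_isZIrred_of_one_mem hp hX h1 hirr hy).diagonal_diag.symm⟩⟩
end
end
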